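/- arXiv:2307.10662 — 2 statements merged into one kernel-verified Lean document; each statement's English description precedes it below -/
import Mathlib

section
/- Let q ≥ 2 and let L_q = ℤ_q ≀ ℤ be the lamplighter group, endowed with the generating set S = {(c δ_0, 1) : c ∈ ℤ/qℤ} ∪ {(c δ_{−1}, −1) : c ∈ ℤ/qℤ} of 2q elements (the generating set for which the Cayley graph of L_q is the Diestel–Leader graph DL(q,q)). Let μ be the uniform probability measure on S (the simple random walk on DL(q,q)). Then there exists a constant C > 0 such that Σ_{x∈S_n} G(e,x) ∼ C n as n → ∞, where S_n is the sphere of radius n for the word length with respect to S and G is the Green function of μ. -/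
open scoped Pointwise Classical
open Filter

namespace GreenGrowth

variable {G : Type*} [Group G]

/-- Word length with respect to a finite generating set `S` (symmetrized). -/
noncomputable def wordLength (S : Finset G) (x : G) : ℕ :=
  sInf {n : ℕ | x ∈ ((S : Set G) ∪ (S : Set G)⁻¹) ^ n}

/-- `n`-step distribution of the `μ`-random walk: the `n`-fold convolution power of `μ`,
so that `p_n(x, y) = convPow μ n (x⁻¹ * y)`. -/
noncomputable def convPow (μ : G → ℝ) : ℕ → G → ℝ
  | 0 => fun x => if x = 1 then 1 else 0
  | n + 1 => fun x => ∑' y : G, μ y * convPow μ n (y⁻¹ * x)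

/-- The Green function `G(e, x | r)`. -/
noncomputable def green (μ : G → ℝ) (r : ℝ) (x : G) : ℝ :=
  ∑' n : ℕ, r ^ n * convPow μ n x

/-- `μ` is a probability measure on `G`. -/
def IsProbMeasure (μ : G → ℝ) : Prop := (∀ x, 0 ≤ μ x) ∧ HasSum μ 1

/-- `μ` is admissible: its support generates `G` as a semigroup, i.e. every element of `G`
is reached with positive probability at some time. -/
def IsAdmissible (μ : G → ℝ) : Prop := ∀ x : G, ∃ n : ℕ, 0 < convPow μ n x

/-- `μ` is symmetric. -/
def IsSymm (μ : G → ℝ) : Prop := ∀ x : G, μ x⁻¹ = μ x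

/-- The spectral radius of the `μ`-random walk. -/
noncomputable def spectralRadius (μ : G → ℝ) : ℝ :=
  limsup (fun n : ℕ => (convPow μ n 1) ^ ((n : ℝ)⁻¹)) atTop

/-- `R`, the radius of convergence of the Green function: the inverse of the
spectral radius. -/
noncomputable def greenRadius (μ : G → ℝ) : ℝ := (spectralRadius μ)⁻¹

/-- The `μ`-random walk is transient at the spectral radius: the Green function
`G(x, y | r)` is finite for all `x, y` and all `0 < r ≤ R`. -/
def TransientAtSpectralRadius (μ : G → ℝ) : Prop :=
  ∀ r : ℝ, 0 < r → r ≤ greenRadius μ →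
    ∀ x : G, Summable (fun n : ℕ => r ^ n * convPow μ n x)

/-- `H_r(n) = Σ_{x ∈ S_n} G(e, x | r)`, the sum of the Green function over the sphere
of radius `n`. -/
noncomputable def greenSphereSum (S : Finset G) (μ : G → ℝ) (r : ℝ) (n : ℕ) : ℝ :=
  ∑' x : G, if wordLength S x = n then green μ r x else 0

/-- `ω_Γ(r) = limsup (1/n) log H_r(n)`, the growth rate of the Green function. -/
noncomputable def greenGrowthRate (S : Finset G) (μ : G → ℝ) (r : ℝ) : ℝ :=
  limsup (fun n : ℕ => Real.log (greenSphereSum S μ r n) / n) atTop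

/-- The cardinality of the sphere of radius `n`. -/
noncomputable def sphereCard (S : Finset G) (n : ℕ) : ℕ :=
  Nat.card {x : G // wordLength S x = n}

/-- The volume growth rate `v = limsup (1/n) log #S_n`. -/
noncomputable def volumeGrowthRate (S : Finset G) : ℝ :=
  limsup (fun n : ℕ => Real.log (sphereCard S n) / n) atTop

end GreenGrowth

namespace GreenGrowth

/-- Lamp configurations: finitely supported functions `ℤ → ℤ/qℤ` (written
multiplicatively). -/
abbrev Lamps (q : ℕ) := Multiplicative (ℤ →₀ ZMod q)

/-- The shift-by-one automorphism of the lamp configurations. -/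
noncomputable def lampShift (q : ℕ) : MulAut (Lamps q) :=
  AddEquiv.toMultiplicative (Finsupp.domCongr (Equiv.addRight (1 : ℤ)))

/-- The shift action of `ℤ` on lamp configurations. -/
noncomputable def lampAction (q : ℕ) : Multiplicative ℤ →* MulAut (Lamps q) :=
  zpowersHom _ (lampShift q)

/-- The lamplighter group `L_q = ℤ_q ≀ ℤ = (⊕_{k∈ℤ} ℤ/qℤ) ⋊ ℤ`. -/
abbrev Lamplighter (q : ℕ) :=
  SemidirectProduct (Lamps q) (Multiplicative ℤ) (lampAction q)

/-- The generating set `S = {(c δ_0, 1)} ∪ {(c δ_{−1}, −1)}`, `c ∈ ℤ/qℤ`, for which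
the Cayley graph of `L_q` is the Diestel–Leader graph `DL(q,q)`. -/
noncomputable def lampGens (q : ℕ) [NeZero q] : Finset (Lamplighter q) :=
  (Finset.univ.image (fun s : ZMod q =>
      (⟨Multiplicative.ofAdd (Finsupp.single (0 : ℤ) s), Multiplicative.ofAdd (1 : ℤ)⟩ :
        Lamplighter q))) ∪
  (Finset.univ.image (fun s : ZMod q =>
      (⟨Multiplicative.ofAdd (Finsupp.single (-1 : ℤ) s), Multiplicative.ofAdd (-1 : ℤ)⟩ :
        Lamplighter q)))

/-- The uniform probability measure on `lampGens q`: the simple random walk on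
`DL(q,q)`. -/
noncomputable def lampMu (q : ℕ) [NeZero q] (x : Lamplighter q) : ℝ :=
  if x ∈ lampGens q then 1 / (2 * q) else 0

/-! ### Multiplication in the lamplighter group -/

/-- The element of the lamplighter group with lamp configuration `f` and position `k`. -/
noncomputable abbrev elt {q : ℕ} (f : ℤ →₀ ZMod q) (k : ℤ) : Lamplighter q :=
  ⟨Multiplicative.ofAdd f, Multiplicative.ofAdd k⟩

theorem lampShift_single {q : ℕ} (j : ℤ) (c : ZMod q) :
    lampShift q (Multiplicative.ofAdd (Finsupp.single j c)) =
      Multiplicative.ofAdd (Finsupp.single (j + 1) c) := by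
  simp [lampShift, AddEquiv.toMultiplicative, Finsupp.domCongr]

theorem lampAction_single {q : ℕ} (k j : ℤ) (c : ZMod q) :
    lampAction q (Multiplicative.ofAdd k) (Multiplicative.ofAdd (Finsupp.single j c)) =
      Multiplicative.ofAdd (Finsupp.single (j + k) c) := by
  have key : ∀ k : ℤ, (lampShift q ^ k) (Multiplicative.ofAdd (Finsupp.single j c)) =
      Multiplicative.ofAdd (Finsupp.single (j + k) c) := by
    intro k
    induction k using Int.induction_on with
    | zero => simp
    | succ i ih =>
      rw [add_comm (i : ℤ) 1, zpow_add, zpow_one, MulAut.mul_apply, ih, lampShift_single]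
      congr 2; ring
    | pred i ih =>
      apply (lampShift q).injective
      rw [lampShift_single, ← MulAut.mul_apply, ← zpow_one_add]
      rw [show (1 + (-(i : ℤ) - 1)) = -i by ring, ih]
      congr 2; ring
  exact key k

theorem elt_mul_up {q : ℕ} (f : ℤ →₀ ZMod q) (k : ℤ) (c : ZMod q) :
    elt f k * elt (Finsupp.single 0 c) 1 = elt (f + Finsupp.single k c) (k + 1) := by
  ext1
  · change Multiplicative.ofAdd f * lampAction q (Multiplicative.ofAdd k) _ = _
    rw [lampAction_single, zero_add]; rfl
  · rfl

theorem elt_mul_down {q : ℕ} (f : ℤ →₀ ZMod q) (k : ℤ) (c : ZMod q) :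
    elt f k * elt (Finsupp.single (-1) c) (-1) =
      elt (f + Finsupp.single (k - 1) c) (k - 1) := by
  ext1
  · change Multiplicative.ofAdd f * lampAction q (Multiplicative.ofAdd k) _ = _
    rw [lampAction_single, neg_add_eq_sub]; rfl
  · rfl

theorem elt_mul_up_inv {q : ℕ} (f : ℤ →₀ ZMod q) (k : ℤ) (c : ZMod q) :
    elt f k * (elt (Finsupp.single 0 c) 1)⁻¹ =
      elt (f - Finsupp.single (k - 1) c) (k - 1) := by
  rw [mul_inv_eq_iff_eq_mul, elt_mul_up]; simp

theorem elt_mul_down_inv {q : ℕ} (f : ℤ →₀ ZMod q) (k : ℤ) (c : ZMod q) :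
    elt f k * (elt (Finsupp.single (-1) c) (-1))⁻¹ =
      elt (f - Finsupp.single k c) (k + 1) := by
  rw [mul_inv_eq_iff_eq_mul, elt_mul_down]; simp

theorem elt_zero {q : ℕ} : (elt 0 0 : Lamplighter q) = 1 := rfl

theorem mem_lampGens {q : ℕ} [NeZero q] {x : Lamplighter q} :
    x ∈ lampGens q ↔ (∃ c, elt (Finsupp.single 0 c) 1 = x) ∨
      ∃ c, elt (Finsupp.single (-1) c) (-1) = x := by
  simp [lampGens]

theorem inv_up {q : ℕ} (c : ZMod q) :
    (elt (Finsupp.single 0 c) 1)⁻¹ = elt (Finsupp.single (-1) (-c)) (-1) := by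
  have h := elt_mul_up_inv (0 : ℤ →₀ ZMod q) 0 c
  rw [elt_zero, one_mul] at h
  rw [h]; simp

theorem inv_down {q : ℕ} (c : ZMod q) :
    (elt (Finsupp.single (-1) c) (-1))⁻¹ = elt (Finsupp.single 0 (-c)) 1 := by
  rw [inv_eq_iff_eq_inv, inv_up, neg_neg]

theorem lampGens_union_inv (q : ℕ) [NeZero q] :
    ((lampGens q : Set (Lamplighter q)) ∪ (lampGens q : Set (Lamplighter q))⁻¹) =
      (lampGens q : Set (Lamplighter q)) := by
  apply Set.union_eq_self_of_subset_right
  intro x hx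
  rw [Set.mem_inv, Finset.mem_coe, mem_lampGens] at hx
  rw [Finset.mem_coe, mem_lampGens]
  rcases hx with ⟨c, hc⟩ | ⟨c, hc⟩
  · right; exact ⟨-c, by rw [← inv_up, hc, inv_inv]⟩
  · left; exact ⟨-c, by rw [← inv_down, hc, inv_inv]⟩

theorem sum_lampGens {q : ℕ} [NeZero q] (F : Lamplighter q → ℝ) :
    ∑ y ∈ lampGens q, F y = ∑ c : ZMod q, F (elt (Finsupp.single 0 c) 1) +
      ∑ c : ZMod q, F (elt (Finsupp.single (-1) c) (-1)) := by
  have inj : ∀ (j k : ℤ), Function.Injective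
      (fun c : ZMod q => (elt (Finsupp.single j c) k : Lamplighter q)) := by
    intro j k c d h
    have h2 := congrArg SemidirectProduct.left h
    exact Finsupp.single_injective j (Multiplicative.ofAdd.injective h2)
  rw [lampGens, Finset.sum_union, Finset.sum_image fun _ _ _ _ h => inj 0 1 h,
    Finset.sum_image fun _ _ _ _ h => inj (-1) (-1) h]
  rw [Finset.disjoint_left]
  intro x hx hy
  obtain ⟨c, -, rfl⟩ := Finset.mem_image.1 hx
  obtain ⟨d, -, h⟩ := Finset.mem_image.1 hy
  have h1 : (-1 : ℤ) = 1 :=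
    Multiplicative.ofAdd.injective (congrArg SemidirectProduct.right h)
  omega

/-! ### Convolution powers -/

theorem convPow_zero {G : Type*} [Group G] (μ : G → ℝ) (x : G) :
    convPow μ 0 x = if x = 1 then 1 else 0 := rfl

theorem convPow_succ {G : Type*} [Group G] (μ : G → ℝ) (n : ℕ) (x : G) :
    convPow μ (n + 1) x = ∑' y : G, μ y * convPow μ n (y⁻¹ * x) := rfl

theorem convPow_lampMu_succ {q : ℕ} [NeZero q] (n : ℕ) (x : Lamplighter q) :
    convPow (lampMu q) (n + 1) x =
      ∑ y ∈ lampGens q, 1 / (2 * q : ℝ) * convPow (lampMu q) n (y⁻¹ * x) := by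
  rw [convPow_succ, tsum_eq_sum (s := lampGens q)]
  · exact Finset.sum_congr rfl fun y hy => by rw [lampMu, if_pos hy]
  · intro y hy
    rw [lampMu, if_neg hy, zero_mul]

theorem convPow_lampMu_succ' {q : ℕ} [NeZero q] (n : ℕ) (x : Lamplighter q) :
    convPow (lampMu q) (n + 1) x =
      ∑ y ∈ lampGens q, 1 / (2 * q : ℝ) * convPow (lampMu q) n (x * y⁻¹) := by
  induction n generalizing x with
  | zero =>
    rw [convPow_lampMu_succ]
    refine Finset.sum_congr rfl fun y _ => ?_
    simp only [convPow_zero, inv_mul_eq_one, mul_inv_eq_one, eq_comm]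
  | succ n ih =>
    rw [convPow_lampMu_succ]
    have h1 : ∀ y : Lamplighter q, convPow (lampMu q) (n + 1) (x * y⁻¹) =
        ∑ w ∈ lampGens q, 1 / (2 * q : ℝ) * convPow (lampMu q) n (w⁻¹ * (x * y⁻¹)) :=
      fun y => convPow_lampMu_succ n _
    simp_rw [h1, ih, Finset.mul_sum]
    rw [Finset.sum_comm]
    simp only [mul_assoc]

/-! ### The range process of the simple random walk on `ℤ` -/

/-- State of the range process: the walker is at `pos`, and the interval visited so far is
`[pos - lft, pos + rgt]`. -/
@[ext] structure RangeState where
  /-- current position -/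
  pos : ℤ
  /-- distance to the left end of the range -/
  lft : ℕ
  /-- distance to the right end of the range -/
  rgt : ℕ

namespace RangeState

/-- The walker steps to the right. -/
def up (z : RangeState) : RangeState := ⟨z.pos + 1, z.lft + 1, z.rgt - 1⟩

/-- The walker steps to the left. -/
def down (z : RangeState) : RangeState := ⟨z.pos - 1, z.lft - 1, z.rgt + 1⟩

/-- The initial state. -/
def start : RangeState := ⟨0, 0, 0⟩

end RangeState

open RangeState

/-- The expectation of `f` after `n` steps of the range process started at `z`. -/
noncomputable def rangeExp : ℕ → (RangeState → ℝ) → RangeState → ℝ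
  | 0 => fun f => f
  | n + 1 => fun f z => (rangeExp n f (up z) + rangeExp n f (down z)) / 2

theorem rangeExp_succ' (n : ℕ) (f : RangeState → ℝ) (z : RangeState) :
    rangeExp (n + 1) f z = rangeExp n (fun z => (f (up z) + f (down z)) / 2) z := by
  induction n generalizing z with
  | zero => rfl
  | succ n ih =>
    change (rangeExp (n + 1) f (up z) + rangeExp (n + 1) f (down z)) / 2 = _
    rw [ih, ih]; rfl

theorem rangeExp_add (n : ℕ) (f g : RangeState → ℝ) (z : RangeState) :
    rangeExp n (fun z => f z + g z) z = rangeExp n f z + rangeExp n g z := by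
  induction n generalizing z with
  | zero => rfl
  | succ n ih => simp only [rangeExp, ih]; ring

theorem rangeExp_const_mul (n : ℕ) (c : ℝ) (f : RangeState → ℝ) (z : RangeState) :
    rangeExp n (fun z => c * f z) z = c * rangeExp n f z := by
  induction n generalizing z with
  | zero => rfl
  | succ n ih => simp only [rangeExp, ih]; ring

theorem rangeExp_sub (n : ℕ) (f g : RangeState → ℝ) (z : RangeState) :
    rangeExp n (fun z => f z - g z) z = rangeExp n f z - rangeExp n g z := by
  induction n generalizing z with
  | zero => rfl
  | succ n ih => simp only [rangeExp, ih]; ring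

theorem rangeExp_mono (n : ℕ) {f g : RangeState → ℝ} (h : ∀ z, f z ≤ g z) (z : RangeState) :
    rangeExp n f z ≤ rangeExp n g z := by
  induction n generalizing z with
  | zero => exact h z
  | succ n ih => simp only [rangeExp]; linarith [ih (up z), ih (down z)]

theorem rangeExp_nonneg (n : ℕ) {f : RangeState → ℝ} (h : ∀ z, 0 ≤ f z) (z : RangeState) :
    0 ≤ rangeExp n f z := by
  induction n generalizing z with
  | zero => exact h z
  | succ n ih => simp only [rangeExp]; linarith [ih (up z), ih (down z)]

theorem rangeExp_zero (n : ℕ) (z : RangeState) : rangeExp n (fun _ => 0) z = 0 := by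
  induction n generalizing z with
  | zero => rfl
  | succ n ih => simp [rangeExp, ih]

theorem hasSum_rangeExp {ι : Type*} (n : ℕ) {F : ι → RangeState → ℝ} {f : RangeState → ℝ}
    (P : RangeState → Prop) (hP : ∀ z, P z → P (up z) ∧ P (down z))
    (h : ∀ z, P z → HasSum (fun i => F i z) (f z)) (z : RangeState) (hz : P z) :
    HasSum (fun i => rangeExp n (F i) z) (rangeExp n f z) := by
  induction n generalizing z with
  | zero => exact h z hz
  | succ n ih => exact ((ih _ (hP z hz).1).add (ih _ (hP z hz).2)).div_const 2

/-- The uniform distribution on the lamplighter elements with walker at `z.pos` and lamps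
supported on the edges of the range of `z`. -/
noncomputable def unif (q : ℕ) (z : RangeState) (f : ℤ →₀ ZMod q) (k : ℤ) : ℝ :=
  if z.pos = k ∧ ∀ i, f i ≠ 0 → k - z.lft ≤ i ∧ i < k + z.rgt
  then ((q : ℝ)⁻¹) ^ (z.lft + z.rgt) else 0

theorem sum_sub_single_of_mem {q : ℕ} [NeZero q] (f : ℤ →₀ ZMod q) (j : ℤ) (P : ℤ → Prop)
    (hj : P j) (a : ℝ) :
    ∑ c : ZMod q, (if ∀ i, (f - Finsupp.single j c) i ≠ 0 → P i then a else 0) =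
      q * if ∀ i, f i ≠ 0 → P i then a else 0 := by
  have : ∀ c : ZMod q, (∀ i, (f - Finsupp.single j c) i ≠ 0 → P i) ↔
      ∀ i, f i ≠ 0 → P i := by
    intro c
    refine forall_congr' fun i => ?_
    rcases eq_or_ne i j with rfl | h
    · simp [hj]
    · simp [h.symm]
  simp only [this, Finset.sum_const, Finset.card_univ, ZMod.card, nsmul_eq_mul]

theorem sum_sub_single_of_notMem {q : ℕ} [NeZero q] (f : ℤ →₀ ZMod q) (j : ℤ)
    (P : ℤ → Prop) (hj : ¬ P j) (a : ℝ) :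
    ∑ c : ZMod q, (if ∀ i, (f - Finsupp.single j c) i ≠ 0 → P i then a else 0) =
      if ∀ i, f i ≠ 0 → P i ∨ i = j then a else 0 := by
  have : ∀ c : ZMod q, (∀ i, (f - Finsupp.single j c) i ≠ 0 → P i) ↔
      (c = f j ∧ ∀ i, f i ≠ 0 → P i ∨ i = j) := by
    intro c
    constructor
    · intro h
      have h1 : c = f j := by
        by_contra hc
        exact hj (h j (by simpa [sub_eq_zero] using fun h => hc h.symm))
      refine ⟨h1, fun i hi => ?_⟩
      rcases eq_or_ne i j with rfl | hij
      · exact Or.inr rfl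
      · left
        apply h i
        simpa [Finsupp.single_apply, hij.symm] using hi
    · rintro ⟨rfl, h⟩ i hi
      rcases eq_or_ne i j with rfl | hij
      · simp at hi
      · exact (h i (by simpa [Finsupp.single_apply, hij.symm] using hi)).resolve_right hij
  simp only [this, ite_and]
  simp

theorem sum_unif_up {q : ℕ} [NeZero q] (z : RangeState) (f : ℤ →₀ ZMod q) (k : ℤ) :
    ∑ c : ZMod q, unif q z (f - Finsupp.single (k - 1) c) (k - 1) =
      q * unif q (up z) f k := by
  have hq : (q : ℝ) ≠ 0 := NeZero.ne _
  obtain ⟨p, l, r⟩ := z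
  simp only [unif, up]
  by_cases hp : p = k - 1
  · subst hp
    simp only [true_and, sub_add_cancel]
    rcases r with _ | r
    · rw [sum_sub_single_of_notMem _ _ (fun i => k - 1 - (l : ℤ) ≤ i ∧ i < k - 1 + ((0 : ℕ) : ℤ))
        (by simp)]
      have : (∀ i, f i ≠ 0 → (k - 1 - (l : ℤ) ≤ i ∧ i < k - 1 + ((0 : ℕ) : ℤ)) ∨ i = k - 1) ↔
          ∀ i, f i ≠ 0 → k - ((l + 1 : ℕ) : ℤ) ≤ i ∧ i < k + ((0 - 1 : ℕ) : ℤ) := by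
        refine forall_congr' fun i => imp_congr_right fun _ => ?_
        push_cast; omega
      rw [if_congr this rfl rfl, mul_ite, mul_zero]
      congr 1
      simp only [add_zero, Nat.zero_sub, pow_succ]
      field_simp
    · rw [sum_sub_single_of_mem _ _ (fun i => k - 1 - (l : ℤ) ≤ i ∧ i < k - 1 + ((r + 1 : ℕ) : ℤ))
        (by push_cast; omega)]
      have : (∀ i, f i ≠ 0 → (k - 1 - (l : ℤ) ≤ i ∧ i < k - 1 + ((r + 1 : ℕ) : ℤ))) ↔
          ∀ i, f i ≠ 0 → k - ((l + 1 : ℕ) : ℤ) ≤ i ∧ i < k + ((r + 1 - 1 : ℕ) : ℤ) := by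
        refine forall_congr' fun i => imp_congr_right fun _ => ?_
        push_cast; omega
      rw [if_congr this rfl rfl]
      congr 3
      omega
  · have : ¬ p + 1 = k := by omega
    simp [hp, this]

theorem sum_unif_down {q : ℕ} [NeZero q] (z : RangeState) (f : ℤ →₀ ZMod q) (k : ℤ) :
    ∑ c : ZMod q, unif q z (f - Finsupp.single k c) (k + 1) =
      q * unif q (down z) f k := by
  have hq : (q : ℝ) ≠ 0 := NeZero.ne _
  obtain ⟨p, l, r⟩ := z
  simp only [unif, down]
  by_cases hp : p = k + 1
  · subst hp
    simp only [true_and, add_sub_cancel_right]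
    rcases l with _ | l
    · rw [sum_sub_single_of_notMem _ _ (fun i => k + 1 - ((0 : ℕ) : ℤ) ≤ i ∧ i < k + 1 + (r : ℤ))
        (by simp)]
      have : (∀ i, f i ≠ 0 → (k + 1 - ((0 : ℕ) : ℤ) ≤ i ∧ i < k + 1 + (r : ℤ)) ∨ i = k) ↔
          ∀ i, f i ≠ 0 → k - ((0 - 1 : ℕ) : ℤ) ≤ i ∧ i < k + ((r + 1 : ℕ) : ℤ) := by
        refine forall_congr' fun i => imp_congr_right fun _ => ?_
        push_cast; omega
      rw [if_congr this rfl rfl, mul_ite, mul_zero]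
      congr 1
      simp only [zero_add, Nat.zero_sub, pow_succ]
      field_simp
    · rw [sum_sub_single_of_mem _ _ (fun i => k + 1 - ((l + 1 : ℕ) : ℤ) ≤ i ∧ i < k + 1 + (r : ℤ))
        (by push_cast; omega)]
      have : (∀ i, f i ≠ 0 → (k + 1 - ((l + 1 : ℕ) : ℤ) ≤ i ∧ i < k + 1 + (r : ℤ))) ↔
          ∀ i, f i ≠ 0 → k - ((l + 1 - 1 : ℕ) : ℤ) ≤ i ∧ i < k + ((r + 1 : ℕ) : ℤ) := by
        refine forall_congr' fun i => imp_congr_right fun _ => ?_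
        push_cast; omega
      rw [if_congr this rfl rfl]
      congr 3
      omega
  · have : ¬ p - 1 = k := by omega
    simp [hp, this]

/-- The lamps along the range of the walk are uniformly distributed. -/
theorem convPow_lampMu_eq {q : ℕ} [NeZero q] (n : ℕ) (f : ℤ →₀ ZMod q) (k : ℤ) :
    convPow (lampMu q) n (elt f k) = rangeExp n (fun z => unif q z f k) start := by
  have hq : (q : ℝ) ≠ 0 := NeZero.ne _
  induction n generalizing f k with
  | zero =>
    rw [convPow_zero]
    change _ = unif q start f k
    have : (elt f k = 1) ↔ (start.pos = k ∧
        ∀ i, f i ≠ 0 → k - (start.lft : ℤ) ≤ i ∧ i < k + (start.rgt : ℤ)) := by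
      simp only [start]
      constructor
      · intro h
        rw [← elt_zero] at h
        have h1 : f = 0 := Multiplicative.ofAdd.injective (congrArg SemidirectProduct.left h)
        have h2 : k = 0 := Multiplicative.ofAdd.injective (congrArg SemidirectProduct.right h)
        subst h1 h2
        simp
      · rintro ⟨rfl, h⟩
        have h1 : f = 0 := by
          ext1 i
          by_contra hi
          have := h i hi
          omega
        rw [h1, elt_zero]
    by_cases h : elt f k = 1
    · rw [if_pos h, unif, if_pos (this.1 h)]
      simp [start]
    · rw [if_neg h, unif, if_neg fun h' => h (this.2 h')]
  | succ n ih =>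
    rw [convPow_lampMu_succ', sum_lampGens, rangeExp_succ']
    simp only [elt_mul_up_inv, elt_mul_down_inv, ih]
    rw [← Finset.mul_sum, ← Finset.mul_sum]
    have hs : ∀ (F : ZMod q → RangeState → ℝ),
        ∑ c, rangeExp n (F c) start = rangeExp n (fun z => ∑ c, F c z) start := by
      intro F
      refine (hasSum_fintype _).unique (hasSum_rangeExp n (fun _ => True) (by simp) ?_ _ trivial)
      intro z _
      exact hasSum_fintype _
    rw [hs, hs]
    simp only [sum_unif_up, sum_unif_down]
    rw [rangeExp_const_mul, rangeExp_const_mul]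
    have : (fun z => (unif q (up z) f k + unif q (down z) f k) / 2) =
        fun z => (1 / 2) * (unif q (up z) f k + unif q (down z) f k) := by
      ext z; ring
    rw [this, rangeExp_const_mul, rangeExp_add]
    field_simp

/-! ### The Green function of the range process -/

/-- The range of `z` is contained in `[-α, β]`. -/
def RangeState.Within (α β : ℤ) (z : RangeState) : Prop :=
  -α ≤ z.pos - z.lft ∧ z.pos + z.rgt ≤ β

theorem within_up {α β : ℤ} {z : RangeState} :
    (up z).Within α β ↔ z.Within α β ∧ z.pos + 1 ≤ β := by
  simp only [Within, up]; omega

theorem within_down {α β : ℤ} {z : RangeState} :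
    (down z).Within α β ↔ z.Within α β ∧ -α ≤ z.pos - 1 := by
  simp only [Within, down]; omega

theorem dirichlet_equation {α β : ℤ} {φ ψ : ℤ → ℝ} (hl : φ (-α - 1) = 0) (hr : φ (β + 1) = 0)
    (h : ∀ s, -α ≤ s → s ≤ β → φ s = ψ s + (φ (s + 1) + φ (s - 1)) / 2) (z : RangeState) :
    (if z.Within α β then φ z.pos else 0) = (if z.Within α β then ψ z.pos else 0) +
      ((if (up z).Within α β then φ (up z).pos else 0) +
        (if (down z).Within α β then φ (down z).pos else 0)) / 2 := by
  by_cases hz : z.Within α β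
  · have h1 : (if (up z).Within α β then φ (up z).pos else 0) = φ (z.pos + 1) := by
      split_ifs with h'
      · rfl
      · rw [within_up] at h'
        have h2 := hz.2
        have : z.pos + 1 = β + 1 := by
          have : ¬ z.pos + 1 ≤ β := fun h3 => h' ⟨hz, h3⟩
          omega
        rw [this, hr]
    have h2 : (if (down z).Within α β then φ (down z).pos else 0) = φ (z.pos - 1) := by
      split_ifs with h'
      · rfl
      · rw [within_down] at h'
        have h2 := hz.1
        have : z.pos - 1 = -α - 1 := by
          have : ¬ -α ≤ z.pos - 1 := fun h3 => h' ⟨hz, h3⟩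
          omega
        rw [this, hl]
    rw [h1, h2, if_pos hz, if_pos hz]
    apply h
    · have := hz.1; omega
    · have := hz.2; omega
  · rw [if_neg hz, if_neg hz, if_neg fun h => hz (within_up.1 h).1,
      if_neg fun h => hz (within_down.1 h).1]
    norm_num

theorem sum_rangeExp_eq {V h : RangeState → ℝ}
    (hV : ∀ z, V z = h z + (V (up z) + V (down z)) / 2) (N : ℕ) (z : RangeState) :
    ∑ n ∈ Finset.range N, rangeExp n h z = V z - rangeExp N V z := by
  induction N with
  | zero => simp [rangeExp]
  | succ N ih =>
    rw [Finset.sum_range_succ, ih, rangeExp_succ']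
    have : rangeExp N V z = rangeExp N (fun z => h z + (V (up z) + V (down z)) / 2) z :=
      congrArg (fun f => rangeExp N f z) (funext hV)
    rw [this, rangeExp_add]
    ring

theorem tendsto_rangeExp_within (α β : ℤ) (z : RangeState) :
    Tendsto (fun n => rangeExp n (fun z => if z.Within α β then (1 : ℝ) else 0) z)
      atTop (nhds 0) := by
  have key := sum_rangeExp_eq (dirichlet_equation (α := α) (β := β)
    (φ := fun s => ((s : ℝ) + α + 1) * (β + 1 - s)) (ψ := fun _ => 1)
    (by push_cast; ring) (by push_cast; ring)
    (by intro s _ _; push_cast; ring))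
  refine Summable.tendsto_atTop_zero (summable_of_sum_range_le
    (c := if z.Within α β then ((z.pos : ℝ) + α + 1) * (β + 1 - z.pos) else 0)
    (fun n => rangeExp_nonneg n (fun z => by split_ifs <;> norm_num) z) fun N => ?_)
  rw [key N z]
  refine sub_le_self _ (rangeExp_nonneg N (fun z => ?_) z)
  split_ifs with hz
  · have h1 := hz.1
    have h2 := hz.2
    have h3 : (0 : ℝ) ≤ ((z.pos + α + 1 : ℤ) : ℝ) := by exact_mod_cast (by omega)
    have h4 : (0 : ℝ) ≤ ((β + 1 - z.pos : ℤ) : ℝ) := by exact_mod_cast (by omega)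
    push_cast at h3 h4
    exact mul_nonneg h3 h4
  · exact le_rfl

/-- Indicator of the states with position `κ` and range inside `[-α, β]`. -/
noncomputable def withinAt (α β κ : ℤ) (z : RangeState) : ℝ :=
  if z.Within α β then (if z.pos = κ then 1 else 0) else 0

theorem hasSum_withinAt {α β κ : ℤ} (hα : -α ≤ κ) (hβ : κ ≤ β) (z : RangeState) :
    HasSum (fun n => rangeExp n (withinAt α β κ) z) (if z.Within α β then
      2 * (((min z.pos κ : ℤ) : ℝ) + α + 1) * (β + 1 - ((max z.pos κ : ℤ) : ℝ)) /
        (α + β + 2) else 0) := by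
  have hpos : (0 : ℝ) < (α : ℝ) + β + 2 := by
    have : (0 : ℝ) < ((α + β + 2 : ℤ) : ℝ) := by exact_mod_cast (by omega)
    push_cast at this; exact this
  set φ : ℤ → ℝ := fun s => 2 * (((min s κ : ℤ) : ℝ) + α + 1) *
    (β + 1 - ((max s κ : ℤ) : ℝ)) / (α + β + 2) with hφ
  have key := sum_rangeExp_eq (dirichlet_equation (α := α) (β := β)
    (φ := φ) (ψ := fun s => if s = κ then 1 else 0)
    (by simp only [hφ]; rw [min_eq_left (by omega)]; push_cast; ring)
    (by simp only [hφ]; rw [max_eq_left (by omega)]; push_cast; ring)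
    (by
      intro s _ _
      simp only [hφ]
      rcases lt_trichotomy s κ with h | h | h
      · rw [min_eq_left h.le, max_eq_right h.le, min_eq_left (by omega), max_eq_right (by omega),
          min_eq_left (by omega), max_eq_right (by omega), if_neg h.ne]
        push_cast; ring
      · subst h
        rw [min_self, max_self, min_eq_right (by omega), max_eq_left (by omega),
          min_eq_left (by omega), max_eq_right (by omega), if_pos rfl]
        push_cast; field_simp; ring
      · rw [min_eq_right h.le, max_eq_left h.le, min_eq_right (by omega), max_eq_left (by omega),
          min_eq_right (by omega), max_eq_left (by omega), if_neg h.ne']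
        push_cast; ring))
  have hM : ∀ s, -α ≤ s → s ≤ β → 0 ≤ φ s ∧
      φ s ≤ 2 * ((α : ℝ) + β + 1) * (α + β + 1) / (α + β + 2) := by
    intro s h1 h2
    have a1 : (0 : ℝ) ≤ ((min s κ + α + 1 : ℤ) : ℝ) := by exact_mod_cast (by omega)
    have a2 : (0 : ℝ) ≤ ((β + 1 - max s κ : ℤ) : ℝ) := by exact_mod_cast (by omega)
    have a3 : ((min s κ + α + 1 : ℤ) : ℝ) ≤ ((α + β + 1 : ℤ) : ℝ) := by
      exact_mod_cast (by omega)
    have a4 : ((β + 1 - max s κ : ℤ) : ℝ) ≤ ((α + β + 1 : ℤ) : ℝ) := by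
      exact_mod_cast (by omega)
    have e : φ s = 2 * ((min s κ + α + 1 : ℤ) : ℝ) * ((β + 1 - max s κ : ℤ) : ℝ) /
        (α + β + 2) := by
      simp only [hφ]; push_cast; ring
    have e2 : ((α : ℝ) + β + 1) = ((α + β + 1 : ℤ) : ℝ) := by push_cast; ring
    rw [e, e2]
    refine ⟨by positivity, ?_⟩
    have a5 := a1.trans a3
    gcongr
  change HasSum (fun n => rangeExp n (withinAt α β κ) z)
    ((fun z : RangeState => if z.Within α β then φ z.pos else 0) z)
  rw [hasSum_iff_tendsto_nat_of_nonneg]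
  · have key' : ∀ N, ∑ n ∈ Finset.range N, rangeExp n (withinAt α β κ) z = _ :=
      fun N => key N z
    simp only [key']
    set K := 2 * ((α : ℝ) + β + 1) * (α + β + 1) / (α + β + 2)
    have lim : Tendsto (fun N => rangeExp N
        (fun z : RangeState => if z.Within α β then φ z.pos else 0) z) atTop (nhds 0) := by
      refine squeeze_zero (fun n => rangeExp_nonneg n (fun w => ?_) z)
        (fun n => ?_) (by simpa using (tendsto_rangeExp_within α β z).const_mul K)
      · split_ifs with hw
        · have h1 := hw.1
          have h2 := hw.2
          exact (hM _ (by omega) (by omega)).1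
        · exact le_rfl
      · rw [← rangeExp_const_mul]
        refine rangeExp_mono n (fun w => ?_) z
        split_ifs with hw
        · have h1 := hw.1
          have h2 := hw.2
          rw [mul_one]
          exact (hM _ (by omega) (by omega)).2
        · simp
    simpa using tendsto_const_nhds.sub lim
  · intro n
    refine rangeExp_nonneg n (fun w => ?_) z
    unfold withinAt
    split_ifs <;> norm_num

theorem hasSum_withinAt_start (κ : ℤ) (a b : ℕ) :
    HasSum (fun n => rangeExp n (withinAt (max 0 (-κ) + a - 1) (max 0 κ + b - 1) κ) start)
      (2 * a * b / (a + b + κ.natAbs)) := by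
  by_cases h : -(max 0 (-κ) + (a : ℤ) - 1) ≤ κ ∧ κ ≤ max 0 κ + b - 1
  · convert hasSum_withinAt h.1 h.2 start using 1
    have hs : start.Within (max 0 (-κ) + a - 1) (max 0 κ + b - 1) ↔ a ≠ 0 ∧ b ≠ 0 := by
      simp only [Within, start]; omega
    by_cases hab : a ≠ 0 ∧ b ≠ 0
    · rw [if_pos (hs.2 hab)]
      have h1 : (min start.pos κ : ℤ) = -max 0 (-κ) := by simp only [start]; omega
      have h2 : (max start.pos κ : ℤ) = max 0 κ := rfl
      have h3 : (κ.natAbs : ℝ) = ((max 0 (-κ) + max 0 κ : ℤ) : ℝ) := by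
        rw [← Int.cast_natCast]
        congr 1; omega
      rw [h1, h2, h3]
      generalize max 0 (-κ) = u
      generalize max 0 κ = v
      push_cast
      congr 1 <;> ring
    · rw [if_neg fun h' => hab (hs.1 h')]
      have : a = 0 ∨ b = 0 := by omega
      rcases this with rfl | rfl <;> simp
  · have h0 : withinAt (max 0 (-κ) + a - 1) (max 0 κ + b - 1) κ = fun _ => 0 := by
      ext z
      unfold withinAt
      split_ifs with h1 h2
      · exfalso
        have h3 := h1.1
        have h4 := h1.2
        omega
      · rfl
      · rfl
    have : a = 0 ∨ b = 0 := by omega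
    simp only [h0, rangeExp_zero]
    rcases this with rfl | rfl <;> simp [hasSum_zero]

/-- Indicator of the states with position `κ` and range `[-α, β]`. -/
noncomputable def exactAt (α β κ : ℤ) (z : RangeState) : ℝ :=
  if z.pos - z.lft = -α ∧ z.pos + z.rgt = β ∧ z.pos = κ then 1 else 0

theorem exactAt_eq (α β κ : ℤ) (z : RangeState) :
    exactAt α β κ z = withinAt α β κ z - withinAt (α - 1) β κ z - withinAt α (β - 1) κ z +
      withinAt (α - 1) (β - 1) κ z := by
  obtain ⟨p, l, r⟩ := z
  simp only [exactAt, withinAt, Within]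
  rcases lt_trichotomy (p - (l : ℤ)) (-α) with h1 | h1 | h1 <;>
  rcases lt_trichotomy (p + (r : ℤ)) β with h2 | h2 | h2 <;>
  by_cases h3 : p = κ <;>
  split_ifs <;> first | (exfalso; omega) | norm_num

/-- The expected number of visits of the simple random walk to a point at distance `k` from the
origin while its range exceeds the segment between the two points by exactly `i` and `j`. -/
noncomputable def rangeGreen (k i j : ℕ) : ℝ :=
  2 * (i + 1) * (j + 1) / (i + j + k + 2) - 2 * i * (j + 1) / (i + j + k + 1) -
    2 * (i + 1) * j / (i + j + k + 1) + 2 * i * j / (i + j + k)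

theorem hasSum_exactAt (κ : ℤ) (i j : ℕ) :
    HasSum (fun n => rangeExp n (exactAt (max 0 (-κ) + i) (max 0 κ + j) κ) start)
      (rangeGreen κ.natAbs i j) := by
  have h := (((hasSum_withinAt_start κ (i + 1) (j + 1)).sub
    (hasSum_withinAt_start κ i (j + 1))).sub
    (hasSum_withinAt_start κ (i + 1) j)).add (hasSum_withinAt_start κ i j)
  have e : exactAt (max 0 (-κ) + i) (max 0 κ + j) κ = fun z =>
      withinAt (max 0 (-κ) + (i + 1 : ℕ) - 1) (max 0 κ + (j + 1 : ℕ) - 1) κ z -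
        withinAt (max 0 (-κ) + i - 1) (max 0 κ + (j + 1 : ℕ) - 1) κ z -
        withinAt (max 0 (-κ) + (i + 1 : ℕ) - 1) (max 0 κ + j - 1) κ z +
        withinAt (max 0 (-κ) + i - 1) (max 0 κ + j - 1) κ z := by
    ext z
    rw [exactAt_eq]
    push_cast
    simp only [← add_assoc, add_sub_cancel_right]
  have hv : rangeGreen κ.natAbs i j =
      2 * ((i + 1 : ℕ) : ℝ) * ((j + 1 : ℕ) : ℝ) /
        (((i + 1 : ℕ) : ℝ) + ((j + 1 : ℕ) : ℝ) + κ.natAbs) -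
      2 * i * ((j + 1 : ℕ) : ℝ) / (i + ((j + 1 : ℕ) : ℝ) + κ.natAbs) -
      2 * ((i + 1 : ℕ) : ℝ) * j / (((i + 1 : ℕ) : ℝ) + j + κ.natAbs) +
      2 * i * j / (i + j + κ.natAbs) := by
    unfold rangeGreen
    push_cast
    congr 3 <;> ring
  rw [e, hv]
  simp only [rangeExp_add, rangeExp_sub]
  exact h

theorem rangeGreen_nonneg (k i j : ℕ) : 0 ≤ rangeGreen k i j := by
  have h := hasSum_exactAt k i j
  rw [Int.natAbs_natCast] at h
  refine h.nonneg fun n => rangeExp_nonneg n (fun z => ?_) _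
  unfold exactAt
  split_ifs <;> norm_num

theorem rangeGreen_eq (k i j : ℕ) (h : 0 < i + j + k) :
    rangeGreen k i j = 2 * (2 * (i + 1) * (j + 1) + (i + j + k + 2) * (k - 1)) /
      ((i + j + k + 2) * (i + j + k + 1) * (i + j + k)) := by
  have h1 : (0 : ℝ) < (i : ℝ) + j + k := by exact_mod_cast h
  have h2 : (i : ℝ) + j + k + 1 ≠ 0 := by positivity
  have h3 : (i : ℝ) + j + k + 2 ≠ 0 := by positivity
  have h4 := h1.ne'
  rw [rangeGreen]
  field_simp
  ring

theorem rangeGreen_le (k i j : ℕ) : rangeGreen k i j ≤ 14 / (i + j + k + 2) := by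
  rcases Nat.eq_zero_or_pos (i + j + k) with h | h
  · obtain ⟨rfl, rfl, rfl⟩ : i = 0 ∧ j = 0 ∧ k = 0 := by omega
    norm_num [rangeGreen]
  · rw [rangeGreen_eq k i j h]
    have h1 : (1 : ℝ) ≤ (i : ℝ) + j + k := by exact_mod_cast h
    have hi : (0 : ℝ) ≤ i := by positivity
    have hj : (0 : ℝ) ≤ j := by positivity
    have hk : (0 : ℝ) ≤ k := by positivity
    rw [div_le_div_iff₀ (by positivity) (by positivity)]
    have e1 : 2 * ((i : ℝ) + 1) * (j + 1) + (i + j + k + 2) * (k - 1) ≤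
        7 * (i + j + k + 1) * (i + j + k) := by
      nlinarith [mul_nonneg hi hj, mul_nonneg hi hk, mul_nonneg hj hk, sq_nonneg (i - j : ℝ)]
    calc _ = 2 * (i + j + k + 2 : ℝ) *
          (2 * ((i : ℝ) + 1) * (j + 1) + (i + j + k + 2) * (k - 1)) := by ring
      _ ≤ 2 * (i + j + k + 2 : ℝ) * (7 * (i + j + k + 1) * (i + j + k)) := by gcongr
      _ = _ := by ring


/-! ### The word length -/

/-- The interval `[-a, b]` contains the origin, the position and all the lit edges. -/
def Covers {q : ℕ} (f : ℤ →₀ ZMod q) (k : ℤ) (a b : ℕ) : Prop :=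
  -(a : ℤ) ≤ k ∧ k ≤ b ∧ ∀ i, f i ≠ 0 → -(a : ℤ) ≤ i ∧ i < b

theorem exists_covers_of_mem_pow {q : ℕ} [NeZero q] (n : ℕ) {x : Lamplighter q}
    (hx : x ∈ (lampGens q : Set (Lamplighter q)) ^ n) :
    ∃ f k a b, x = elt f k ∧ Covers f k a b ∧ 2 * (a + b) ≤ n + k.natAbs := by
  induction n generalizing x with
  | zero =>
    rw [pow_zero, Set.mem_one] at hx
    exact ⟨0, 0, 0, 0, hx, by simp [Covers], by simp⟩
  | succ n ih =>
    rw [pow_succ, Set.mem_mul] at hx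
    obtain ⟨y, hy, s, hs, rfl⟩ := hx
    obtain ⟨f, k, a, b, rfl, ⟨h1, h2, h3⟩, h4⟩ := ih hy
    rw [Finset.mem_coe, mem_lampGens] at hs
    rcases hs with ⟨c, rfl⟩ | ⟨c, rfl⟩
    · refine ⟨_, _, a, max b (k + 1).toNat, elt_mul_up f k c, ⟨by omega, by omega, ?_⟩, by omega⟩
      intro i hi
      rcases eq_or_ne i k with rfl | hik
      · omega
      · have := h3 i (by simpa [Finsupp.single_apply, hik.symm] using hi)
        omega
    · refine ⟨_, _, max a (1 - k).toNat, b, elt_mul_down f k c, ⟨by omega, by omega, ?_⟩, by omega⟩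
      intro i hi
      rcases eq_or_ne i (k - 1) with rfl | hik
      · omega
      · have := h3 i (by simpa [Finsupp.single_apply, hik.symm] using hi)
        omega

theorem Covers.mem_pow {q : ℕ} [NeZero q] (n : ℕ) {f : ℤ →₀ ZMod q} {k : ℤ} {a b : ℕ}
    (h : Covers f k a b) (hn : n + k.natAbs = 2 * (a + b)) :
    elt f k ∈ (lampGens q : Set (Lamplighter q)) ^ n := by
  have up_mem : ∀ c : ZMod q, elt (Finsupp.single 0 c) 1 ∈ (lampGens q : Set (Lamplighter q)) :=
    fun c => mem_lampGens.2 (Or.inl ⟨c, rfl⟩)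
  have down_mem : ∀ c : ZMod q,
      elt (Finsupp.single (-1) c) (-1) ∈ (lampGens q : Set (Lamplighter q)) :=
    fun c => mem_lampGens.2 (Or.inr ⟨c, rfl⟩)
  induction n generalizing f k a b with
  | zero =>
    obtain ⟨h1, h2, h3⟩ := h
    have hk : k = 0 := by omega
    have hf : f = 0 := by
      ext1 i
      by_contra hi
      have := h3 i hi
      omega
    rw [pow_zero, hk, hf, elt_zero]
    exact Set.one_mem_one
  | succ n ih =>
    obtain ⟨h1, h2, h3⟩ := h
    rw [pow_succ]
    by_cases c1 : 0 ≤ k ∧ k < b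
    · have e : elt f k = elt f (k + 1) * elt (Finsupp.single (-1) 0) (-1) := by
        rw [elt_mul_down]; simp
      rw [e]
      exact Set.mul_mem_mul (ih (a := a) (b := b) ⟨by omega, by omega, h3⟩ (by omega))
        (down_mem 0)
    by_cases c2 : k ≤ 0 ∧ -(a : ℤ) < k
    · have e : elt f k = elt f (k - 1) * elt (Finsupp.single 0 0) 1 := by
        rw [elt_mul_up]; simp
      rw [e]
      exact Set.mul_mem_mul (ih (a := a) (b := b) ⟨by omega, by omega, h3⟩ (by omega))
        (up_mem 0)
    by_cases c3 : 0 < k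
    · have e : elt f k = elt (f - Finsupp.single (k - 1) (f (k - 1))) (k - 1) *
          elt (Finsupp.single 0 (f (k - 1))) 1 := by
        rw [elt_mul_up]; simp
      rw [e]
      refine Set.mul_mem_mul (ih (a := a) (b := b - 1) ⟨by omega, by omega, ?_⟩ (by omega))
        (up_mem _)
      intro i hi
      rcases eq_or_ne i (k - 1) with rfl | hik
      · simp at hi
      · have := h3 i (by simpa [Finsupp.single_apply, hik.symm] using hi)
        omega
    · have e : elt f k = elt (f - Finsupp.single k (f k)) (k + 1) *
          elt (Finsupp.single (-1) (f k)) (-1) := by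
        rw [elt_mul_down]; simp
      rw [e]
      refine Set.mul_mem_mul (ih (a := a - 1) (b := b) ⟨by omega, by omega, ?_⟩ (by omega))
        (down_mem _)
      intro i hi
      rcases eq_or_ne i k with rfl | hik
      · simp at hi
      · have := h3 i (by simpa [Finsupp.single_apply, hik.symm] using hi)
        omega

/-- How far the lit edges extend to the left of the segment between `0` and `k`. -/
noncomputable def leftExcess {q : ℕ} (f : ℤ →₀ ZMod q) (k : ℤ) : ℕ :=
  sInf {a : ℕ | ∀ i, f i ≠ 0 → min 0 k - a ≤ i}

/-- How far the lit edges extend to the right of the segment between `0` and `k`. -/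
noncomputable def rightExcess {q : ℕ} (f : ℤ →₀ ZMod q) (k : ℤ) : ℕ :=
  sInf {b : ℕ | ∀ i, f i ≠ 0 → i < max 0 k + b}

theorem leftExcess_le {q : ℕ} {f : ℤ →₀ ZMod q} {k : ℤ} {a : ℕ} :
    leftExcess f k ≤ a ↔ ∀ i, f i ≠ 0 → min 0 k - a ≤ i := by
  refine ⟨fun h i hi => ?_, fun h => Nat.sInf_le h⟩
  have hne : {a : ℕ | ∀ i, f i ≠ 0 → min 0 k - a ≤ i}.Nonempty := by
    refine ⟨∑ i ∈ f.support, (min 0 k - i).natAbs, fun i hi => ?_⟩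
    have := Finset.single_le_sum (f := fun i => (min 0 k - i).natAbs) (fun i _ => Nat.zero_le _)
      (Finsupp.mem_support_iff.2 hi)
    omega
  have := Nat.sInf_mem hne i hi
  change min 0 k - (leftExcess f k : ℤ) ≤ i at this
  omega

theorem rightExcess_le {q : ℕ} {f : ℤ →₀ ZMod q} {k : ℤ} {b : ℕ} :
    rightExcess f k ≤ b ↔ ∀ i, f i ≠ 0 → i < max 0 k + b := by
  refine ⟨fun h i hi => ?_, fun h => Nat.sInf_le h⟩
  have hne : {b : ℕ | ∀ i, f i ≠ 0 → i < max 0 k + b}.Nonempty := by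
    refine ⟨∑ i ∈ f.support, (i + 1 - max 0 k).natAbs, fun i hi => ?_⟩
    have := Finset.single_le_sum (f := fun i => (i + 1 - max 0 k).natAbs)
      (fun i _ => Nat.zero_le _) (Finsupp.mem_support_iff.2 hi)
    omega
  have := Nat.sInf_mem hne i hi
  change i < max 0 k + (rightExcess f k : ℤ) at this
  omega

theorem covers_iff {q : ℕ} {f : ℤ →₀ ZMod q} {k : ℤ} {a b : ℕ} :
    Covers f k a b ↔ max 0 (-k) + leftExcess f k ≤ a ∧ max 0 k + rightExcess f k ≤ b := by
  constructor
  · rintro ⟨h1, h2, h3⟩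
    have hl : leftExcess f k ≤ (a - max 0 (-k)).toNat := by
      rw [leftExcess_le]
      intro i hi
      have := h3 i hi
      omega
    have hr : rightExcess f k ≤ (b - max 0 k).toNat := by
      rw [rightExcess_le]
      intro i hi
      have := h3 i hi
      omega
    omega
  · rintro ⟨h1, h2⟩
    refine ⟨by omega, by omega, fun i hi => ?_⟩
    have hl := leftExcess_le.1 (le_refl (leftExcess f k)) i hi
    have hr := rightExcess_le.1 (le_refl (rightExcess f k)) i hi
    omega

theorem wordLength_elt {q : ℕ} [NeZero q] (f : ℤ →₀ ZMod q) (k : ℤ) :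
    wordLength (lampGens q) (elt f k) =
      k.natAbs + 2 * leftExcess f k + 2 * rightExcess f k := by
  rw [wordLength, lampGens_union_inv]
  have hmem : elt f k ∈ (lampGens q : Set (Lamplighter q)) ^
      (k.natAbs + 2 * leftExcess f k + 2 * rightExcess f k) :=
    Covers.mem_pow _ (a := (-k).toNat + leftExcess f k) (b := k.toNat + rightExcess f k)
      (covers_iff.2 (by omega)) (by omega)
  refine le_antisymm (Nat.sInf_le hmem) (le_csInf ⟨_, hmem⟩ fun n hn => ?_)
  obtain ⟨f', k', a, b, he, hc, hle⟩ := exists_covers_of_mem_pow n hn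
  have h1 : f = f' := Multiplicative.ofAdd.injective (congrArg SemidirectProduct.left he)
  have h2 : k = k' := Multiplicative.ofAdd.injective (congrArg SemidirectProduct.right he)
  subst h1 h2
  have := covers_iff.1 hc
  omega

/-! ### The Green function of the lamplighter walk -/

theorem hasSum_unif {q : ℕ} (f : ℤ →₀ ZMod q) (κ : ℤ) (z : RangeState)
    (hz : z.pos - z.lft ≤ 0 ∧ 0 ≤ z.pos + z.rgt) :
    HasSum (fun p : ℕ × ℕ =>
      ((q : ℝ)⁻¹) ^ (κ.natAbs + (leftExcess f κ + p.1) + (rightExcess f κ + p.2)) *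
        exactAt (max 0 (-κ) + (leftExcess f κ + p.1 : ℕ))
          (max 0 κ + (rightExcess f κ + p.2 : ℕ)) κ z) (unif q z f κ) := by
  have hcov : (∀ i, f i ≠ 0 → κ - z.lft ≤ i ∧ i < κ + z.rgt) → z.pos = κ →
      max 0 (-κ) + leftExcess f κ ≤ z.lft - z.pos ∧ max 0 κ + rightExcess f κ ≤ z.pos + z.rgt := by
    intro h hp
    have := (covers_iff (f := f) (k := κ) (a := (z.lft - z.pos).toNat)
      (b := (z.pos + z.rgt).toNat)).1 ⟨by omega, by omega, fun i hi => by
        have := h i hi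
        omega⟩
    omega
  by_cases h : z.pos = κ ∧ ∀ i, f i ≠ 0 → κ - z.lft ≤ i ∧ i < κ + z.rgt
  · obtain ⟨h1, h2⟩ := hcov h.2 h.1
    obtain ⟨i, hi⟩ := Int.le.dest h1
    obtain ⟨j, hj⟩ := Int.le.dest h2
    convert hasSum_single (i, j) ?_ using 1
    · rw [unif, if_pos h, exactAt, if_pos (by push_cast; omega), mul_one]
      congr 1
      simp only
      omega
    · rintro ⟨i', j'⟩ hne
      rw [exactAt, if_neg, mul_zero]
      rintro ⟨h3, h4, -⟩
      apply hne
      ext <;> push_cast at * <;> omega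
  · rw [unif, if_neg h]
    convert hasSum_zero with p
    rw [exactAt, if_neg, mul_zero]
    rintro ⟨h1, h2, h3⟩
    refine h ⟨h3, fun i hi => ?_⟩
    have hl := leftExcess_le.1 (le_refl (leftExcess f κ)) i hi
    have hr := rightExcess_le.1 (le_refl (rightExcess f κ)) i hi
    push_cast at *
    omega

theorem hasSum_pow_add (r : ℝ) (h0 : 0 ≤ r) (h1 : r < 1) :
    HasSum (fun p : ℕ × ℕ => r ^ (p.1 + p.2)) ((1 - r)⁻¹ * (1 - r)⁻¹) := by
  simp only [pow_add]
  have h := hasSum_geometric_of_lt_one h0 h1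
  exact h.mul h (h.summable.mul_of_nonneg h.summable (fun n => by positivity)
    (fun n => by positivity))

theorem rangeGreen_le_seven (k i j : ℕ) : rangeGreen k i j ≤ 7 := by
  refine (rangeGreen_le k i j).trans ?_
  rw [div_le_iff₀ (by positivity)]
  have : (0 : ℝ) ≤ (i : ℝ) + j + k := by positivity
  linarith

/-- The Green function of the lamplighter walk at a point of position `±k` and excesses `A`, `B`,
up to the factor `q ^ (k + A + B)`. -/
noncomputable def greenSeries (q k A B : ℕ) : ℝ :=
  ∑' p : ℕ × ℕ, ((q : ℝ)⁻¹) ^ (p.1 + p.2) * rangeGreen k (A + p.1) (B + p.2)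

theorem inv_lt_one_of_two_le {q : ℕ} (hq : 2 ≤ q) : (q : ℝ)⁻¹ < 1 :=
  inv_lt_one_of_one_lt₀ (by exact_mod_cast hq)

theorem summable_greenSeries {q : ℕ} (hq : 2 ≤ q) (k A B : ℕ) :
    Summable fun p : ℕ × ℕ =>
      ((q : ℝ)⁻¹) ^ (p.1 + p.2) * rangeGreen k (A + p.1) (B + p.2) := by
  refine Summable.of_nonneg_of_le (fun p => mul_nonneg (by positivity) (rangeGreen_nonneg _ _ _))
    (fun p => mul_le_mul_of_nonneg_left (rangeGreen_le_seven _ _ _) (by positivity))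
    ((hasSum_pow_add _ (by positivity) (inv_lt_one_of_two_le hq)).summable.mul_right 7)

theorem hasSum_convPow {q : ℕ} [NeZero q] (hq : 2 ≤ q) (f : ℤ →₀ ZMod q) (κ : ℤ) :
    HasSum (fun n => convPow (lampMu q) n (elt f κ))
      (((q : ℝ)⁻¹) ^ (κ.natAbs + leftExcess f κ + rightExcess f κ) *
        greenSeries q κ.natAbs (leftExcess f κ) (rightExcess f κ)) := by
  set A := leftExcess f κ
  set B := rightExcess f κ
  set F : (ℕ × ℕ) → ℕ → ℝ := fun p n =>
    ((q : ℝ)⁻¹) ^ (κ.natAbs + (A + p.1) + (B + p.2)) *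
      rangeExp n (exactAt (max 0 (-κ) + (A + p.1 : ℕ)) (max 0 κ + (B + p.2 : ℕ)) κ) start with hF
  have hF0 : ∀ x : (ℕ × ℕ) × ℕ, 0 ≤ F x.1 x.2 := fun x =>
    mul_nonneg (by positivity)
      (rangeExp_nonneg _ (fun z => by unfold exactAt; split_ifs <;> norm_num) _)
  have hFn : ∀ p, HasSum (F p) (((q : ℝ)⁻¹) ^ (κ.natAbs + A + B) *
      (((q : ℝ)⁻¹) ^ (p.1 + p.2) * rangeGreen κ.natAbs (A + p.1) (B + p.2))) := by
    intro p
    have := (hasSum_exactAt κ (A + p.1) (B + p.2)).mul_left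
      (((q : ℝ)⁻¹) ^ (κ.natAbs + (A + p.1) + (B + p.2)))
    rw [← mul_assoc, ← pow_add, show κ.natAbs + A + B + (p.1 + p.2) =
      κ.natAbs + (A + p.1) + (B + p.2) by ring]
    exact this
  have hFp : ∀ n, HasSum (fun p => F p n) (convPow (lampMu q) n (elt f κ)) := by
    intro n
    rw [convPow_lampMu_eq]
    simp only [hF, ← rangeExp_const_mul]
    refine hasSum_rangeExp n (fun z => z.pos - z.lft ≤ 0 ∧ 0 ≤ z.pos + z.rgt) ?_ ?_ start
      (by simp [start])
    · intro z hz
      simp only [up, down]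
      omega
    · intro z hz
      exact hasSum_unif f κ z hz
  have hS : Summable fun x : (ℕ × ℕ) × ℕ => F x.1 x.2 := by
    refine (summable_prod_of_nonneg hF0).2 ⟨fun p => (hFn p).summable, ?_⟩
    simp only [fun p => (hFn p).tsum_eq]
    exact (summable_greenSeries hq _ A B).mul_left _
  have h1 := hS.hasSum.prod_fiberwise hFn
  have h2 : HasSum (fun p : ℕ × ℕ => ((q : ℝ)⁻¹) ^ (κ.natAbs + A + B) *
      (((q : ℝ)⁻¹) ^ (p.1 + p.2) * rangeGreen κ.natAbs (A + p.1) (B + p.2)))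
      (((q : ℝ)⁻¹) ^ (κ.natAbs + A + B) * greenSeries q κ.natAbs A B) :=
    (summable_greenSeries hq _ A B).hasSum.mul_left _
  have h3 : HasSum (fun x : ℕ × (ℕ × ℕ) => F x.2 x.1) (∑' x : (ℕ × ℕ) × ℕ, F x.1 x.2) :=
    (Equiv.prodComm ℕ (ℕ × ℕ)).hasSum_iff.2 hS.hasSum
  rw [← h2.unique h1] at h3
  exact h3.prod_fiberwise hFp

theorem green_elt {q : ℕ} [NeZero q] (hq : 2 ≤ q) (f : ℤ →₀ ZMod q) (κ : ℤ) :
    green (lampMu q) 1 (elt f κ) =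
      ((q : ℝ)⁻¹) ^ (κ.natAbs + leftExcess f κ + rightExcess f κ) *
        greenSeries q κ.natAbs (leftExcess f κ) (rightExcess f κ) := by
  simp only [green, one_pow, one_mul]
  exact (hasSum_convPow hq f κ).tsum_eq

/-! ### Counting lamp configurations -/

/-- The lamp configurations with excesses at most `a` and `b` over the segment from `0` to `k`. -/
noncomputable def lampBall (q : ℕ) [NeZero q] (k : ℤ) (a b : ℕ) : Finset (ℤ →₀ ZMod q) :=
  (Finset.Ico (min 0 k - a) (max 0 k + b)).finsupp fun _ => Finset.univ

theorem mem_lampBall {q : ℕ} [NeZero q] {k : ℤ} {a b : ℕ} {f : ℤ →₀ ZMod q} :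
    f ∈ lampBall q k a b ↔ leftExcess f k ≤ a ∧ rightExcess f k ≤ b := by
  rw [lampBall, Finset.mem_finsupp_iff, leftExcess_le, rightExcess_le]
  simp only [Finset.mem_univ, implies_true, and_true, Finset.subset_iff, Finsupp.mem_support_iff,
    Finset.mem_Ico, ← forall_and]

theorem card_lampBall (q : ℕ) [NeZero q] (k : ℤ) (a b : ℕ) :
    (lampBall q k a b).card = q ^ (k.natAbs + a + b) := by
  rw [lampBall, Finset.card_finsupp]
  simp only [Finset.card_univ, ZMod.card, Finset.prod_const, Int.card_Ico]
  congr 1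
  omega

/-- The proportion of sequences of length `a` with entries in `ZMod q` whose last entry does not
vanish. -/
noncomputable def excessWeight (q a : ℕ) : ℝ := if a = 0 then 1 else 1 - (q : ℝ)⁻¹

theorem card_filter_eq_of_card_le {X : Type*} {q : ℕ} [NeZero q] {K : ℝ} {ℓ : X → ℕ}
    {P : X → Prop} {S : ℕ → Finset X} (hS : ∀ a x, x ∈ S a ↔ ℓ x ≤ a ∧ P x)
    (hc : ∀ a, ((S a).card : ℝ) = K * q ^ a) (a : ℕ) :
    (((S a).filter fun x => ℓ x = a).card : ℝ) = excessWeight q a * K * q ^ a := by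
  rcases a with _ | a
  · rw [Finset.filter_true_of_mem fun x hx => Nat.le_zero.1 ((hS 0 x).1 hx).1, hc, excessWeight,
      if_pos rfl]
    ring
  · have h : (S (a + 1)).filter (fun x => ¬ ℓ x = a + 1) = S a := by
      ext x
      simp only [Finset.mem_filter, hS]
      constructor
      · rintro ⟨⟨h1, h2⟩, h3⟩
        exact ⟨by omega, h2⟩
      · rintro ⟨h1, h2⟩
        exact ⟨⟨by omega, h2⟩, by omega⟩
    have h1 := Finset.card_filter_add_card_filter_not (s := S (a + 1)) (fun x => ℓ x = a + 1)
    rw [h] at h1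
    have h2 : ((((S (a + 1)).filter fun x => ℓ x = a + 1).card : ℝ)) + (S a).card =
      (S (a + 1)).card := by exact_mod_cast h1
    rw [hc, hc] at h2
    have hq : (q : ℝ) ≠ 0 := NeZero.ne _
    rw [excessWeight, if_neg (by omega), eq_sub_of_add_eq h2]
    field_simp
    ring

theorem card_excess_eq {q : ℕ} [NeZero q] (k : ℤ) (A B : ℕ) :
    (((lampBall q k A B).filter fun f => leftExcess f k = A ∧ rightExcess f k = B).card : ℝ) =
      excessWeight q A * excessWeight q B * q ^ (k.natAbs + A + B) := by
  have h1 : ∀ b, (((lampBall q k A b).filter fun f => leftExcess f k = A).card : ℝ) =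
      excessWeight q A * q ^ (k.natAbs + A) * q ^ b := by
    intro b
    rw [card_filter_eq_of_card_le (q := q) (K := q ^ (k.natAbs + b))
      (S := fun a => lampBall q k a b) (fun a f => mem_lampBall)
      (fun a => by rw [card_lampBall]; push_cast; ring) A]
    ring
  have h2 := card_filter_eq_of_card_le (q := q) (ℓ := fun f => rightExcess f k)
    (P := fun f => leftExcess f k = A)
    (S := fun b => (lampBall q k A b).filter fun f => leftExcess f k = A)
    (fun b f => by rw [Finset.mem_filter, mem_lampBall]; omega) h1 B
  rw [Finset.filter_filter] at h2
  rw [h2]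
  ring

/-! ### The sphere sum of the Green function -/

/-- The contribution to the sphere sum of the points with excesses `A` and `B`. -/
noncomputable def sphereTerm (q n A B : ℕ) : ℝ :=
  if 2 * A + 2 * B ≤ n then (if 2 * A + 2 * B = n then 1 else 2) *
    (excessWeight q A * excessWeight q B * greenSeries q (n - 2 * A - 2 * B) A B) else 0

theorem sum_ite_natAbs (n m : ℕ) (h : m ≤ n) (c : ℝ) :
    ∑ κ ∈ Finset.Icc (-n : ℤ) n, (if κ.natAbs = m then c else 0) =
      (if m = 0 then 1 else 2) * c := by
  rw [← Finset.sum_filter]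
  have : (Finset.Icc (-n : ℤ) n).filter (fun κ => κ.natAbs = m) = {(m : ℤ), -(m : ℤ)} := by
    ext κ
    simp only [Finset.mem_filter, Finset.mem_Icc, Finset.mem_insert, Finset.mem_singleton]
    omega
  rw [this]
  rcases eq_or_ne m 0 with rfl | hm
  · simp
  · rw [Finset.sum_pair (by omega), if_neg hm]
    ring

theorem sum_lampBall {q : ℕ} [NeZero q] (κ : ℤ) (n : ℕ) (φ : ℕ → ℕ → ℝ)
    (hφ : ∀ A B, n ≤ A ∨ n ≤ B → φ A B = 0) :
    ∑ f ∈ lampBall q κ n n, φ (leftExcess f κ) (rightExcess f κ) =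
      ∑ A ∈ Finset.range n, ∑ B ∈ Finset.range n,
        excessWeight q A * excessWeight q B * q ^ (κ.natAbs + A + B) * φ A B := by
  have h1 : ∀ f : ℤ →₀ ZMod q, φ (leftExcess f κ) (rightExcess f κ) =
      ∑ A ∈ Finset.range n, ∑ B ∈ Finset.range n,
        if leftExcess f κ = A ∧ rightExcess f κ = B then φ A B else 0 := by
    intro f
    simp only [ite_and, Finset.sum_ite_irrel, Finset.sum_const_zero, Finset.sum_ite_eq,
      Finset.mem_range]
    split_ifs with h h'
    · rfl
    · exact hφ _ _ (Or.inr (by omega))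
    · exact hφ _ _ (Or.inl (by omega))
  rw [Finset.sum_congr rfl fun f _ => h1 f, Finset.sum_comm]
  refine Finset.sum_congr rfl fun A hA => ?_
  rw [Finset.sum_comm]
  refine Finset.sum_congr rfl fun B hB => ?_
  rw [← Finset.sum_filter, Finset.sum_const, nsmul_eq_mul, ← card_excess_eq]
  congr 3
  ext f
  rw [Finset.mem_range] at hA hB
  simp only [Finset.mem_filter, mem_lampBall]
  omega

theorem greenSphereSum_eq {q : ℕ} [NeZero q] (hq : 2 ≤ q) {n : ℕ} (hn : 0 < n) :
    greenSphereSum (lampGens q) (lampMu q) 1 n =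
      ∑ A ∈ Finset.range n, ∑ B ∈ Finset.range n, sphereTerm q n A B := by
  have hq0 : (q : ℝ) ≠ 0 := NeZero.ne _
  let e : (Σ _ : ℤ, ℤ →₀ ZMod q) → Lamplighter q := fun p => elt p.2 p.1
  have he : Function.Injective e := by
    rintro ⟨k, f⟩ ⟨k', f'⟩ h
    have h1 : f = f' := Multiplicative.ofAdd.injective (congrArg SemidirectProduct.left h)
    have h2 : k = k' := Multiplicative.ofAdd.injective (congrArg SemidirectProduct.right h)
    rw [h1, h2]
  rw [greenSphereSum, tsum_eq_sum (s := ((Finset.Icc (-n : ℤ) n).sigma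
    fun κ => lampBall q κ n n).image e), Finset.sum_image he.injOn, Finset.sum_sigma]
  · simp only [e, wordLength_elt, green_elt hq]
    have h1 : ∀ κ ∈ Finset.Icc (-n : ℤ) n, _ = _ := fun κ _ =>
      sum_lampBall (q := q) κ n (fun A B => if κ.natAbs + 2 * A + 2 * B = n then
        ((q : ℝ)⁻¹) ^ (κ.natAbs + A + B) * greenSeries q κ.natAbs A B else 0)
        (fun A B h => if_neg (by omega))
    rw [Finset.sum_congr rfl h1, Finset.sum_comm]
    refine Finset.sum_congr rfl fun A hA => ?_
    rw [Finset.sum_comm]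
    refine Finset.sum_congr rfl fun B hB => ?_
    rw [sphereTerm]
    by_cases h : 2 * A + 2 * B ≤ n
    · have h0 : 2 * A + 2 * B = n ↔ n - 2 * A - 2 * B = 0 := by omega
      rw [if_pos h, if_congr h0 rfl rfl, ← sum_ite_natAbs n _ (by omega)]
      refine Finset.sum_congr rfl fun κ _ => ?_
      by_cases hκ : κ.natAbs = n - 2 * A - 2 * B
      · rw [if_pos hκ, if_pos (by omega), ← hκ, inv_pow]
        field_simp
      · rw [if_neg hκ, if_neg (by omega), mul_zero]
    · rw [if_neg h]
      refine Finset.sum_eq_zero fun κ _ => ?_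
      rw [if_neg (by omega), mul_zero]
  · intro x hx
    obtain ⟨f, k⟩ := x
    refine if_neg fun h => hx ?_
    change wordLength (lampGens q) (elt (Multiplicative.toAdd f) (Multiplicative.toAdd k)) = n at h
    rw [wordLength_elt] at h
    refine Finset.mem_image.2 ⟨⟨Multiplicative.toAdd k, Multiplicative.toAdd f⟩, ?_, rfl⟩
    simp only [Finset.mem_sigma, Finset.mem_Icc, mem_lampBall]
    omega

/-! ### Asymptotics -/

theorem average_eq_integral (φ : ℕ → ℝ) {n : ℕ} (hn : 0 < n) :
    (∑ A ∈ Finset.range n, φ A) / n = ∫ s in (0 : ℝ)..1, φ ⌊s * n⌋₊ := by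
  have hn' : (0 : ℝ) < n := by exact_mod_cast hn
  have hcell : ∀ A : ℕ, Set.EqOn (fun s : ℝ => φ ⌊s * n⌋₊) (fun _ => φ A)
      (Set.Ioo ((A : ℝ) / n) (((A + 1 : ℕ) : ℝ) / n)) := by
    intro A s hs
    have h1 : (A : ℝ) < s * n := (div_lt_iff₀ hn').1 hs.1
    have h2 : s * n < (A + 1 : ℕ) := (lt_div_iff₀ hn').1 hs.2
    push_cast at h2
    simp only
    rw [(Nat.floor_eq_iff (by linarith [Nat.cast_nonneg (α := ℝ) A])).2 ⟨h1.le, h2⟩]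
  have hle : ∀ A : ℕ, (A : ℝ) / n ≤ ((A + 1 : ℕ) : ℝ) / n := fun A => by
    gcongr; omega
  have hint : ∀ A < n, IntervalIntegrable (fun s : ℝ => φ ⌊s * n⌋₊) MeasureTheory.volume
      ((A : ℝ) / n) (((A + 1 : ℕ) : ℝ) / n) := by
    intro A _
    refine (intervalIntegrable_const (c := φ A)).congr_uIoo ?_
    rw [Set.uIoo_of_le (hle A)]
    exact (hcell A).symm
  have hsum := intervalIntegral.sum_integral_adjacent_intervals
    (a := fun A : ℕ => (A : ℝ) / n) hint
  simp only [Nat.cast_zero, zero_div, div_self hn'.ne'] at hsum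
  rw [← hsum, Finset.sum_div]
  refine Finset.sum_congr rfl fun A _ => ?_
  rw [intervalIntegral.integral_congr_Ioo_of_le (hle A) (hcell A)]
  simp only [intervalIntegral.integral_const, smul_eq_mul]
  push_cast
  ring

theorem tendsto_average {φ : ℕ → ℕ → ℝ} {g : ℝ → ℝ} {K : ℝ} (hK : ∀ n A, |φ n A| ≤ K)
    (hlim : ∀ᵐ s : ℝ, 0 < s → Tendsto (fun n : ℕ => φ n ⌊s * n⌋₊) atTop (nhds (g s))) :
    Tendsto (fun n : ℕ => (∑ A ∈ Finset.range n, φ n A) / n) atTop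
      (nhds (∫ s in (0 : ℝ)..1, g s)) := by
  have h : Tendsto (fun n : ℕ => ∫ s in (0 : ℝ)..1, φ n ⌊s * n⌋₊) atTop
      (nhds (∫ s in (0 : ℝ)..1, g s)) := by
    refine intervalIntegral.tendsto_integral_filter_of_dominated_convergence (fun _ => K)
      (Eventually.of_forall fun n => ?_) (Eventually.of_forall fun n => ?_)
      intervalIntegrable_const ?_
    · exact ((measurable_from_nat (f := φ n)).comp
        (Nat.measurable_floor.comp (measurable_id.mul_const _))).aestronglyMeasurable
    · exact Eventually.of_forall fun s _ => hK n _
    · filter_upwards [hlim] with s hs hs'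
      rw [Set.uIoc_of_le zero_le_one] at hs'
      exact hs hs'.1
  refine h.congr' ?_
  filter_upwards [eventually_gt_atTop 0] with n hn
  rw [average_eq_integral (φ n) hn]

theorem tendsto_floor_div {s : ℝ} (hs : 0 ≤ s) :
    Tendsto (fun n : ℕ => (⌊s * n⌋₊ : ℝ) / n) atTop (nhds s) :=
  (tendsto_nat_floor_mul_div_atTop hs).comp tendsto_natCast_atTop_atTop

theorem tendsto_mul_rangeGreen {k a b : ℕ → ℕ} {κ s t : ℝ}
    (hk : Tendsto (fun n : ℕ => (k n : ℝ) / n) atTop (nhds κ))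
    (ha : Tendsto (fun n : ℕ => (a n : ℝ) / n) atTop (nhds s))
    (hb : Tendsto (fun n : ℕ => (b n : ℝ) / n) atTop (nhds t)) (h : 0 < s + t + κ) :
    Tendsto (fun n : ℕ => n * rangeGreen (k n) (a n) (b n)) atTop
      (nhds (2 * (2 * s * t + (s + t + κ) * κ) / ((s + t + κ) * (s + t + κ) * (s + t + κ)))) := by
  have h1 : Tendsto (fun n : ℕ => 1 / (n : ℝ)) atTop (nhds 0) :=
    tendsto_one_div_atTop_nhds_zero_nat
  have hσ := (ha.add hb).add hk
  have key := (((((ha.add h1).const_mul 2).mul (hb.add h1)).add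
    ((hσ.add (h1.const_mul 2)).mul (hk.sub h1))).const_mul 2).div
    (((hσ.add (h1.const_mul 2)).mul (hσ.add h1)).mul hσ) (by
      simp only [mul_zero, add_zero]
      positivity)
  simp only [mul_zero, add_zero, sub_zero] at key
  refine key.congr' ?_
  filter_upwards [eventually_gt_atTop 0, hσ.eventually (lt_mem_nhds h)] with n hn hσn
  have hn' : (0 : ℝ) < n := by exact_mod_cast hn
  rw [← add_div, ← add_div] at hσn
  have h2 : (0 : ℝ) < (a n : ℝ) + b n + k n := (div_pos_iff_of_pos_right hn').1 hσn
  have h3 : (a n : ℝ) + b n + k n + 1 ≠ 0 := by positivity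
  have h4 : (a n : ℝ) + b n + k n + 2 ≠ 0 := by positivity
  rw [rangeGreen_eq _ _ _ (by exact_mod_cast h2)]
  have e1 : (a n : ℝ) / n + b n / n + k n / n = (a n + b n + k n) / n := by ring
  have e2 : ((a n : ℝ) + b n + k n) / n + 2 * (1 / n) = (a n + b n + k n + 2) / n := by ring
  have e3 : ((a n : ℝ) + b n + k n) / n + 1 / n = (a n + b n + k n + 1) / n := by ring
  simp only [Pi.div_apply, e1, e2, e3]
  field_simp

theorem excessWeight_nonneg {q : ℕ} (hq : 2 ≤ q) (a : ℕ) : 0 ≤ excessWeight q a := by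
  have := inv_lt_one_of_two_le hq
  unfold excessWeight
  split_ifs <;> linarith

theorem excessWeight_le_one {q : ℕ} (a : ℕ) : excessWeight q a ≤ 1 := by
  have : (0 : ℝ) ≤ (q : ℝ)⁻¹ := by positivity
  unfold excessWeight
  split_ifs <;> linarith

theorem half_le_excessWeight {q : ℕ} (hq : 2 ≤ q) (a : ℕ) : 1 / 2 ≤ excessWeight q a := by
  have : (q : ℝ)⁻¹ ≤ (2 : ℝ)⁻¹ := inv_anti₀ (by norm_num) (by exact_mod_cast hq)
  unfold excessWeight
  split_ifs <;> linarith

theorem greenSeries_nonneg (q k A B : ℕ) : 0 ≤ greenSeries q k A B :=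
  tsum_nonneg fun _ => mul_nonneg (by positivity) (rangeGreen_nonneg _ _ _)

theorem sphereTerm_nonneg {q : ℕ} (hq : 2 ≤ q) (n A B : ℕ) : 0 ≤ sphereTerm q n A B := by
  unfold sphereTerm
  have := excessWeight_nonneg hq A
  have := excessWeight_nonneg hq B
  have := greenSeries_nonneg q (n - 2 * A - 2 * B) A B
  split_ifs <;> positivity

theorem mul_rangeGreen_le {n A B : ℕ} (h : 2 * A + 2 * B ≤ n) (i j : ℕ) :
    n * rangeGreen (n - 2 * A - 2 * B) (A + i) (B + j) ≤ 28 := by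
  have h1 := rangeGreen_le (n - 2 * A - 2 * B) (A + i) (B + j)
  have h2 : n ≤ 2 * ((A + i) + (B + j) + (n - 2 * A - 2 * B) + 2) := by omega
  have h3 : (n : ℝ) ≤ 2 * (((A + i : ℕ) : ℝ) + ((B + j : ℕ) : ℝ) +
      ((n - 2 * A - 2 * B : ℕ) : ℝ) + 2) := by exact_mod_cast h2
  calc _ ≤ (n : ℝ) * (14 / (((A + i : ℕ) : ℝ) + ((B + j : ℕ) : ℝ) +
        ((n - 2 * A - 2 * B : ℕ) : ℝ) + 2)) := by gcongr
    _ ≤ 28 := by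
      rw [mul_div_assoc', div_le_iff₀ (by positivity)]
      linarith

theorem mul_greenSeries_le {q : ℕ} (hq : 2 ≤ q) {n A B : ℕ} (h : 2 * A + 2 * B ≤ n) :
    n * greenSeries q (n - 2 * A - 2 * B) A B ≤
      (1 - (q : ℝ)⁻¹)⁻¹ * (1 - (q : ℝ)⁻¹)⁻¹ * 28 := by
  rw [greenSeries, ← tsum_mul_left]
  refine hasSum_le (fun p => ?_) ((summable_greenSeries hq _ _ _).mul_left _).hasSum
    ((hasSum_pow_add _ (by positivity) (inv_lt_one_of_two_le hq)).mul_right 28)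
  rw [mul_left_comm]
  exact mul_le_mul_of_nonneg_left (mul_rangeGreen_le h _ _) (by positivity)

theorem abs_mul_sphereTerm_le {q : ℕ} (hq : 2 ≤ q) (n A B : ℕ) :
    |n * sphereTerm q n A B| ≤ 2 * ((1 - (q : ℝ)⁻¹)⁻¹ * (1 - (q : ℝ)⁻¹)⁻¹ * 28) := by
  rw [abs_of_nonneg (mul_nonneg (Nat.cast_nonneg _) (sphereTerm_nonneg hq n A B))]
  have h0 : 0 < 1 - (q : ℝ)⁻¹ := sub_pos.2 (inv_lt_one_of_two_le hq)
  unfold sphereTerm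
  by_cases h : 2 * A + 2 * B ≤ n
  · rw [if_pos h]
    have h1 := mul_greenSeries_le hq h
    have h2 := greenSeries_nonneg q (n - 2 * A - 2 * B) A B
    have h3 : excessWeight q A * excessWeight q B ≤ 1 :=
      mul_le_one₀ (excessWeight_le_one A) (excessWeight_nonneg hq B) (excessWeight_le_one B)
    have h4 := mul_nonneg (excessWeight_nonneg hq A) (excessWeight_nonneg hq B)
    have h5 : (if 2 * A + 2 * B = n then (1 : ℝ) else 2) ≤ 2 := by split_ifs <;> norm_num
    have h6 : 0 ≤ (if 2 * A + 2 * B = n then (1 : ℝ) else 2) := by split_ifs <;> norm_num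
    calc _ = (if 2 * A + 2 * B = n then (1 : ℝ) else 2) *
          (excessWeight q A * excessWeight q B *
            (n * greenSeries q (n - 2 * A - 2 * B) A B)) := by ring
      _ ≤ 2 * (1 * ((1 - (q : ℝ)⁻¹)⁻¹ * (1 - (q : ℝ)⁻¹)⁻¹ * 28)) := by gcongr
      _ = _ := by ring
  · rw [if_neg h, mul_zero]
    positivity

/-- The limit of `n * rangeGreen` at macroscopic excesses `s` and `t`. -/
noncomputable def greenDensity (s t : ℝ) : ℝ :=
  2 * (2 * s * t + (s + t + (1 - 2 * s - 2 * t)) * (1 - 2 * s - 2 * t)) /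
    ((s + t + (1 - 2 * s - 2 * t)) * (s + t + (1 - 2 * s - 2 * t)) *
      (s + t + (1 - 2 * s - 2 * t)))

theorem tendsto_mul_greenSeries {q : ℕ} (hq : 2 ≤ q) {A B : ℕ → ℕ} {s t : ℝ}
    (hA : Tendsto (fun n : ℕ => (A n : ℝ) / n) atTop (nhds s))
    (hB : Tendsto (fun n : ℕ => (B n : ℝ) / n) atTop (nhds t)) (hst : s + t < 1 / 2)
    (hle : ∀ᶠ n in atTop, 2 * A n + 2 * B n ≤ n) :
    Tendsto (fun n : ℕ => n * greenSeries q (n - 2 * A n - 2 * B n) (A n) (B n)) atTop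
      (nhds ((1 - (q : ℝ)⁻¹)⁻¹ * (1 - (q : ℝ)⁻¹)⁻¹ * greenDensity s t)) := by
  have hgeo := hasSum_pow_add (q : ℝ)⁻¹ (by positivity) (inv_lt_one_of_two_le hq)
  have hk : Tendsto (fun n : ℕ => ((n - 2 * A n - 2 * B n : ℕ) : ℝ) / n) atTop
      (nhds (1 - 2 * s - 2 * t)) := by
    refine (((tendsto_const_nhds (x := (1 : ℝ))).sub (hA.const_mul 2)).sub
      (hB.const_mul 2)).congr' ?_
    filter_upwards [hle, eventually_gt_atTop 0] with n hn hn0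
    have hn' : (n : ℝ) ≠ 0 := by exact_mod_cast hn0.ne'
    rw [Nat.sub_sub, Nat.cast_sub hn]
    push_cast
    field_simp
    ring
  have hshift : ∀ {a : ℕ → ℕ} {u : ℝ} (i : ℕ),
      Tendsto (fun n : ℕ => (a n : ℝ) / n) atTop (nhds u) →
      Tendsto (fun n : ℕ => ((a n + i : ℕ) : ℝ) / n) atTop (nhds u) := by
    intro a u i ha
    have := ha.add (tendsto_const_div_atTop_nhds_zero_nat (i : ℝ))
    rw [add_zero] at this
    refine this.congr fun n => ?_
    push_cast
    ring
  simp only [greenSeries, ← tsum_mul_left]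
  rw [← (hgeo.mul_right (greenDensity s t)).tsum_eq]
  refine tendsto_tsum_of_dominated_convergence (hgeo.mul_right 28).summable (fun p => ?_) ?_
  · simp only [mul_left_comm (_ : ℝ) (((q : ℝ)⁻¹) ^ (p.1 + p.2))]
    exact (tendsto_mul_rangeGreen hk (hshift p.1 hA) (hshift p.2 hB) (by linarith)).const_mul _
  · filter_upwards [hle] with n hn p
    rw [mul_left_comm, Real.norm_of_nonneg (mul_nonneg (by positivity)
      (mul_nonneg (by positivity) (rangeGreen_nonneg _ _ _)))]
    exact mul_le_mul_of_nonneg_left (mul_rangeGreen_le hn _ _) (by positivity)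

theorem tendsto_mul_sphereTerm {q : ℕ} (hq : 2 ≤ q) {s t : ℝ} (hs : 0 < s) (ht : 0 < t)
    (hst : s + t ≠ 1 / 2) :
    Tendsto (fun n : ℕ => n * sphereTerm q n ⌊s * n⌋₊ ⌊t * n⌋₊) atTop
      (nhds (if s + t < 1 / 2 then 2 * greenDensity s t else 0)) := by
  have hA := tendsto_floor_div hs.le
  have hB := tendsto_floor_div ht.le
  have hAB := hA.add hB
  rcases lt_or_gt_of_ne hst with h | h
  · rw [if_pos h]
    have hlt : ∀ᶠ n : ℕ in atTop, 2 * ⌊s * n⌋₊ + 2 * ⌊t * n⌋₊ < n := by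
      filter_upwards [hAB.eventually (gt_mem_nhds h), eventually_gt_atTop 0] with n hn hn0
      have hn' : (0 : ℝ) < n := by exact_mod_cast hn0
      rw [← add_div, div_lt_iff₀ hn'] at hn
      have : (2 * ⌊s * n⌋₊ + 2 * ⌊t * n⌋₊ : ℝ) < n := by linarith
      exact_mod_cast this
    have hpos : ∀ {u : ℝ}, 0 < u → ∀ᶠ n : ℕ in atTop, ⌊u * n⌋₊ ≠ 0 := by
      intro u hu
      filter_upwards [(tendsto_floor_div hu.le).eventually (lt_mem_nhds hu)] with n hn h0
      rw [h0] at hn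
      simp at hn
    have h0 : (1 - (q : ℝ)⁻¹) ≠ 0 := (sub_pos.2 (inv_lt_one_of_two_le hq)).ne'
    have key := (tendsto_mul_greenSeries hq hA hB h (hlt.mono fun _ => le_of_lt)).const_mul
      (2 * ((1 - (q : ℝ)⁻¹) * (1 - (q : ℝ)⁻¹)))
    have e : 2 * ((1 - (q : ℝ)⁻¹) * (1 - (q : ℝ)⁻¹)) *
        ((1 - (q : ℝ)⁻¹)⁻¹ * (1 - (q : ℝ)⁻¹)⁻¹ * greenDensity s t) = 2 * greenDensity s t := by
      generalize 1 - (q : ℝ)⁻¹ = x at h0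
      field_simp
    rw [e] at key
    refine key.congr' ?_
    filter_upwards [hlt, hpos hs, hpos ht] with n hn hsn htn
    rw [sphereTerm, if_pos hn.le, if_neg hn.ne, excessWeight, excessWeight, if_neg hsn,
      if_neg htn]
    ring
  · rw [if_neg h.not_gt]
    refine tendsto_const_nhds.congr' ?_
    filter_upwards [hAB.eventually (lt_mem_nhds h), eventually_gt_atTop 0] with n hn hn0
    have hn' : (0 : ℝ) < n := by exact_mod_cast hn0
    rw [← add_div, lt_div_iff₀ hn'] at hn
    have h1 : (n : ℝ) < 2 * ⌊s * n⌋₊ + 2 * ⌊t * n⌋₊ := by linarith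
    have h2 : n < 2 * ⌊s * n⌋₊ + 2 * ⌊t * n⌋₊ := by exact_mod_cast h1
    rw [sphereTerm, if_neg (by omega), mul_zero]

theorem tendsto_sum_sphereTerm {q : ℕ} (hq : 2 ≤ q) :
    Tendsto (fun n : ℕ =>
      (∑ A ∈ Finset.range n, ∑ B ∈ Finset.range n, sphereTerm q n A B) / n) atTop
      (nhds (∫ s in (0 : ℝ)..1, ∫ t in (0 : ℝ)..1,
        if s + t < 1 / 2 then 2 * greenDensity s t else 0)) := by
  set K := 2 * ((1 - (q : ℝ)⁻¹)⁻¹ * (1 - (q : ℝ)⁻¹)⁻¹ * 28)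
  have key := tendsto_average (K := K) (φ := fun n A =>
      (∑ B ∈ Finset.range n, n * sphereTerm q n A B) / n)
    (g := fun s => ∫ t in (0 : ℝ)..1, if s + t < 1 / 2 then 2 * greenDensity s t else 0) ?_ ?_
  · refine key.congr' ?_
    filter_upwards [eventually_gt_atTop 0] with n hn
    have hn' : (n : ℝ) ≠ 0 := by exact_mod_cast hn.ne'
    simp only [← Finset.mul_sum, mul_div_cancel_left₀ _ hn']
  · intro n A
    rw [abs_div, Nat.abs_cast]
    rcases Nat.eq_zero_or_pos n with rfl | hn
    · have hK : 0 ≤ K := (abs_nonneg _).trans (abs_mul_sphereTerm_le hq 0 0 0)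
      simpa using hK
    · rw [div_le_iff₀ (by exact_mod_cast hn)]
      refine (Finset.abs_sum_le_sum_abs _ _).trans
        ((Finset.sum_le_sum fun B _ => abs_mul_sphereTerm_le hq n A B).trans ?_)
      rw [Finset.sum_const, Finset.card_range, nsmul_eq_mul, mul_comm]
  · refine Eventually.of_forall fun s hs => ?_
    refine tendsto_average (K := K) (φ := fun n B => n * sphereTerm q n ⌊s * n⌋₊ B)
      (fun n B => abs_mul_sphereTerm_le hq n _ B) ?_
    filter_upwards [MeasureTheory.Measure.ae_ne MeasureTheory.volume (1 / 2 - s)] with t ht ht0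
    exact tendsto_mul_sphereTerm hq hs ht0 (fun h => ht (by linarith))

theorem le_mul_sphereTerm {q : ℕ} (hq : 2 ≤ q) {n A B : ℕ} (hn : 5 ≤ n) (hA : 8 * A ≤ n)
    (hB : 8 * B ≤ n) : 1 / 4 ≤ n * sphereTerm q n A B := by
  have hn' : (0 : ℝ) < n := by exact_mod_cast (by omega)
  have hk : 2 * (n - 2 * A - 2 * B) ≥ n := by omega
  have hN : A + B + (n - 2 * A - 2 * B) ≤ n := by omega
  have hgreen : (1 : ℝ) / 2 ≤ n * rangeGreen (n - 2 * A - 2 * B) A B := by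
    rw [rangeGreen_eq _ _ _ (by omega), mul_div_assoc']
    generalize n - 2 * A - 2 * B = k at *
    have hk' : (n : ℝ) ≤ 2 * k := by exact_mod_cast hk
    have hN' : (A : ℝ) + B + k ≤ n := by exact_mod_cast hN
    have hn5 : (5 : ℝ) ≤ n := by exact_mod_cast hn
    have hA0 : (0 : ℝ) ≤ A := Nat.cast_nonneg A
    have hB0 : (0 : ℝ) ≤ B := Nat.cast_nonneg B
    have hM : (0 : ℝ) < A + B + k := by linarith
    have hk1 : (0 : ℝ) ≤ k - 1 := by linarith
    rw [le_div_iff₀ (by positivity)]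
    generalize (A : ℝ) + B + k = N at *
    have h1 : (N + 1) * N ≤ 4 * n * (k - 1 : ℝ) := by nlinarith
    have h2 : (0 : ℝ) ≤ n * ((A + 1) * (B + 1)) := by positivity
    have h3 := mul_le_mul_of_nonneg_left h1 (by linarith : 0 ≤ N + 2)
    linarith
  have hseries : rangeGreen (n - 2 * A - 2 * B) A B ≤
      greenSeries q (n - 2 * A - 2 * B) A B := by
    have := (summable_greenSeries hq (n - 2 * A - 2 * B) A B).le_tsum (0, 0) fun p _ =>
      mul_nonneg (by positivity) (rangeGreen_nonneg _ _ _)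
    simpa [greenSeries] using this
  have h1 := half_le_excessWeight hq A
  have h2 := half_le_excessWeight hq B
  rw [sphereTerm, if_pos (by omega), if_neg (by omega)]
  calc (1 : ℝ) / 4 = 2 * (1 / 2 * (1 / 2) * (1 / 2)) := by norm_num
    _ ≤ 2 * (excessWeight q A * excessWeight q B *
        (n * rangeGreen (n - 2 * A - 2 * B) A B)) := by gcongr
    _ ≤ 2 * (excessWeight q A * excessWeight q B *
        (n * greenSeries q (n - 2 * A - 2 * B) A B)) := by
      have := mul_nonneg (excessWeight_nonneg hq A) (excessWeight_nonneg hq B)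
      gcongr
    _ = _ := by ring

theorem le_sum_sphereTerm {q : ℕ} (hq : 2 ≤ q) {n : ℕ} (hn : 5 ≤ n) :
    1 / 256 ≤ (∑ A ∈ Finset.range n, ∑ B ∈ Finset.range n, sphereTerm q n A B) / n := by
  have hn' : (0 : ℝ) < n := by exact_mod_cast (by omega)
  have hsub : Finset.range (n / 8 + 1) ⊆ Finset.range n := by
    intro A
    simp only [Finset.mem_range]
    omega
  have h1 : (n : ℝ) / 8 ≤ ((n / 8 + 1 : ℕ) : ℝ) := by
    rw [div_le_iff₀ (by norm_num)]
    exact_mod_cast (by omega)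
  have h2 : ((n / 8 + 1 : ℕ) : ℝ) * (((n / 8 + 1 : ℕ) : ℝ) * (1 / (4 * n))) ≤
      ∑ A ∈ Finset.range n, ∑ B ∈ Finset.range n, sphereTerm q n A B := by
    have h3 : ∀ A ∈ Finset.range (n / 8 + 1), ∀ B ∈ Finset.range (n / 8 + 1),
        1 / (4 * n : ℝ) ≤ sphereTerm q n A B := by
      intro A hA B hB
      rw [Finset.mem_range] at hA hB
      have := le_mul_sphereTerm hq hn (A := A) (B := B) (by omega) (by omega)
      rw [div_le_iff₀ (by positivity)]
      linarith
    rw [← nsmul_eq_mul, ← nsmul_eq_mul]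
    calc _ ≤ ∑ A ∈ Finset.range (n / 8 + 1), ∑ B ∈ Finset.range (n / 8 + 1),
          sphereTerm q n A B := by
          have := Finset.sum_le_sum fun A hA => Finset.sum_le_sum fun B hB => h3 A hA B hB
          simpa using this
      _ ≤ ∑ A ∈ Finset.range (n / 8 + 1), ∑ B ∈ Finset.range n, sphereTerm q n A B :=
          Finset.sum_le_sum fun A _ => Finset.sum_le_sum_of_subset_of_nonneg hsub
            fun B _ _ => sphereTerm_nonneg hq n A B
      _ ≤ _ := Finset.sum_le_sum_of_subset_of_nonneg hsub
            fun A _ _ => Finset.sum_nonneg fun B _ => sphereTerm_nonneg hq n A B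
  rw [le_div_iff₀ hn']
  refine le_trans ?_ h2
  calc 1 / 256 * (n : ℝ) = n / 8 * (n / 8 * (1 / (4 * n))) := by
        field_simp
        norm_num
    _ ≤ _ := by gcongr

/-- For the simple random walk on the lamplighter group
`L_q = ℤ_q ≀ ℤ` (with the Diestel–Leader generating set), there is `C > 0` with
`Σ_{x ∈ S_n} G(e,x) ∼ C n`. -/
theorem lamplighter_green_sphere_sum_linear (q : ℕ) [NeZero q] (hq : 2 ≤ q) :
    ∃ C : ℝ, 0 < C ∧
      Tendsto (fun n : ℕ => greenSphereSum (lampGens q) (lampMu q) 1 n / n)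
        atTop (nhds C) := by
  have hlim : Tendsto (fun n : ℕ => greenSphereSum (lampGens q) (lampMu q) 1 n / n) atTop
      (nhds (∫ s in (0 : ℝ)..1, ∫ t in (0 : ℝ)..1,
        if s + t < 1 / 2 then 2 * greenDensity s t else 0)) := by
    refine (tendsto_sum_sphereTerm hq).congr' ?_
    filter_upwards [eventually_gt_atTop 0] with n hn
    rw [greenSphereSum_eq hq hn]
  refine ⟨_, lt_of_lt_of_le (by norm_num : (0 : ℝ) < 1 / 256) (ge_of_tendsto hlim ?_), hlim⟩
  filter_upwards [eventually_ge_atTop 5] with n hn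
  rw [greenSphereSum_eq hq (by omega)]
  exact le_sum_sphereTerm hq hn

end GreenGrowth
end

section
/- Let T_1, T_2 be the regular trees of equal degree l := l_1 = l_2 ≥ 3, and consider on the product graph T_1 × T_2 the kernel p = α_1 p_1 + α_2 p_2 built from the lazy simple random walks p_i, where α_1, α_2 > 0 and α_1 + α_2 = 1. Then for every 0 < r < R there exists C ≥ 1 such that C^{−1} e^{n ω(r)} ≤ H_r(n) ≤ C e^{n ω(r)} for all n ≥ 1; moreover ω(r) = log [ l ( r^{−1} − 1/2 − √((r^{−1} − 1/2)² − (l−1)/l²) ) ]. -/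
open scoped Classical
open Filter

namespace BiTree

/-- `T` is the `l`-regular tree: a connected acyclic graph all of whose vertices have
degree `l`. -/
def IsRegularTree {V : Type*} (T : SimpleGraph V) (l : ℕ) : Prop :=
  T.IsTree ∧ ∀ v : V, (T.neighborSet v).ncard = l

/-- The lazy simple random walk kernel on a graph of degree `l`. -/
noncomputable def lazyKernel {V : Type*} (T : SimpleGraph V) (l : ℕ) (x y : V) : ℝ :=
  if T.Adj x y then 1 / (2 * l) else if x = y then 1 / 2 else 0

/-- `n`-fold iterate of a transition kernel. -/
noncomputable def kernelPow {V : Type*} (p : V → V → ℝ) : ℕ → V → V → ℝ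
  | 0 => fun x y => if x = y then 1 else 0
  | n + 1 => fun x y => ∑' z : V, p x z * kernelPow p n z y

/-- The Green function `G(x, y | r)` of a transition kernel. -/
noncomputable def kernelGreen {V : Type*} (p : V → V → ℝ) (r : ℝ) (x y : V) : ℝ :=
  ∑' n : ℕ, r ^ n * kernelPow p n x y

/-- The kernel `p = α₁ p₁ + α₂ p₂` on the product. -/
noncomputable def prodKernel {V₁ V₂ : Type*} (p₁ : V₁ → V₁ → ℝ) (p₂ : V₂ → V₂ → ℝ)
    (α₁ α₂ : ℝ) (x y : V₁ × V₂) : ℝ :=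
  α₁ * p₁ x.1 y.1 * (if x.2 = y.2 then 1 else 0) +
    α₂ * (if x.1 = y.1 then 1 else 0) * p₂ x.2 y.2

/-- `H_r(n)`: sum of the Green function over the sphere of radius `n` around the root
for the product metric `d((x₁,x₂),(y₁,y₂)) = d₁(x₁,y₁) + d₂(x₂,y₂)`. -/
noncomputable def sphereGreenSum {V₁ V₂ : Type*} (T₁ : SimpleGraph V₁)
    (T₂ : SimpleGraph V₂) (p : V₁ × V₂ → V₁ × V₂ → ℝ) (o : V₁ × V₂) (r : ℝ) (n : ℕ) :
    ℝ :=
  ∑' x : V₁ × V₂,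
    if T₁.dist o.1 x.1 + T₂.dist o.2 x.2 = n then kernelGreen p r o x else 0

/-- The growth rate `ω(r)` of the Green function. -/
noncomputable def omega {V₁ V₂ : Type*} (T₁ : SimpleGraph V₁) (T₂ : SimpleGraph V₂)
    (p : V₁ × V₂ → V₁ × V₂ → ℝ) (o : V₁ × V₂) (r : ℝ) : ℝ :=
  limsup (fun n : ℕ => Real.log (sphereGreenSum T₁ T₂ p o r n) / n) atTop

/-- The spectral radius `ρ = 1/2 + √(l−1)/l` of the lazy simple random walk on the
`l`-regular tree. -/
noncomputable def treeRho (l : ℕ) : ℝ := 1 / 2 + Real.sqrt ((l : ℝ) - 1) / l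

end BiTree

namespace BiTree

section Tree

variable {V : Type*} {T : SimpleGraph V} {l : ℕ}

lemma IsRegularTree.finite_neighborSet (hT : IsRegularTree T l) (hl : 0 < l) (x : V) :
    (T.neighborSet x).Finite :=
  Set.finite_of_ncard_pos (by rw [hT.2 x]; exact hl)

/-- In a tree, a vertex at distance `k + 1` from `o` has exactly one neighbour at
distance `k` from `o`. -/
lemma existsUnique_parent (hT : T.IsTree) {o x : V} {k : ℕ} (hx : T.dist o x = k + 1) :
    ∃! y, T.Adj x y ∧ T.dist o y = k := by
  obtain ⟨p, hp, hlen⟩ := hT.connected.exists_path_of_dist o x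
  have hnil : ¬ p.Nil := by
    intro h
    have := SimpleGraph.Walk.length_eq_zero_iff.2 h
    omega
  have key : ∀ y, T.Adj x y → T.dist o y = k → y = p.penultimate := by
    intro y hy hd
    obtain ⟨q, -, hq⟩ := hT.connected.exists_path_of_dist o y
    have hpath : (q.concat hy.symm).IsPath :=
      SimpleGraph.Walk.isPath_of_length_eq_dist _ (by
        rw [SimpleGraph.Walk.length_concat, hq, hd, hx])
    have heq : p = q.concat hy.symm := (hT.existsUnique_path o x).unique hp hpath
    rw [heq, SimpleGraph.Walk.penultimate_concat]
  have hadj : T.Adj p.penultimate x := p.adj_penultimate hnil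
  refine ⟨p.penultimate, ⟨hadj.symm, ?_⟩, fun y hy => key y hy.1 hy.2⟩
  have h1 : T.dist o p.penultimate ≤ p.dropLast.length := SimpleGraph.dist_le _
  have h2 : p.dropLast.length = p.length - 1 := by simp
  have h3 := hT.dist_eq_dist_add_one_of_adj o hadj
  omega

lemma IsRegularTree.finite_ball (hT : IsRegularTree T l) (hl : 0 < l) (o : V) (n : ℕ) :
    {x : V | T.dist o x ≤ n}.Finite := by
  induction n with
  | zero =>
    refine (Set.finite_singleton o).subset fun x hx => ?_
    have : T.dist o x = 0 := Nat.le_zero.1 hx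
    exact (hT.1.connected.dist_eq_zero_iff.1 this).symm
  | succ n ih =>
    refine (ih.union (ih.biUnion fun x _ => hT.finite_neighborSet hl x)).subset fun x hx => ?_
    rcases Nat.lt_or_ge n (T.dist o x) with h | h
    · have hd : T.dist o x = n + 1 := le_antisymm hx h
      obtain ⟨y, ⟨hy, hyd⟩, -⟩ := existsUnique_parent hT.1 hd
      exact Or.inr (Set.mem_biUnion (x := y) (by simp [hyd]) hy.symm)
    · exact Or.inl h

lemma lazyKernel_nonneg (x y : V) : 0 ≤ lazyKernel T l x y := by
  unfold lazyKernel
  split_ifs <;> positivity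

lemma adj_or_eq_of_lazyKernel_ne_zero {x y : V} (h : lazyKernel T l x y ≠ 0) :
    T.Adj x y ∨ x = y := by
  unfold lazyKernel at h
  split_ifs at h <;> tauto

lemma dist_le_add_one_of_lazyKernel_ne_zero (hT : T.IsTree) (o : V) {x y : V}
    (h : lazyKernel T l x y ≠ 0) : T.dist o y ≤ T.dist o x + 1 := by
  rcases adj_or_eq_of_lazyKernel_ne_zero h with h | rfl
  · have := hT.dist_eq_dist_add_one_of_adj o h
    omega
  · exact Nat.le_succ _

lemma IsRegularTree.finite_support_lazyKernel (hT : IsRegularTree T l) (hl : 0 < l) (x : V) :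
    (Function.support (lazyKernel T l x)).Finite := by
  refine ((hT.finite_neighborSet hl x).insert x).subset fun y hy => ?_
  rcases adj_or_eq_of_lazyKernel_ne_zero hy with h | h
  · exact Or.inr h
  · exact Or.inl h.symm

/-- A radial solution of the one-dimensional eigenvalue equations gives an eigenfunction
of the lazy simple random walk on the regular tree. -/
lemma IsRegularTree.hasSum_lazyKernel_radial (hT : IsRegularTree T l) (hl : 0 < l) (o x : V)
    {f : ℕ → ℝ} {μ : ℝ} (h0 : f 0 / 2 + f 1 / 2 = μ * f 0)
    (h1 : ∀ k, f (k + 1) / 2 + (f k + (l - 1) * f (k + 2)) / (2 * l) = μ * f (k + 1)) :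
    HasSum (fun z => lazyKernel T l x z * f (T.dist o z)) (μ * f (T.dist o x)) := by
  have hl' : (l : ℝ) ≠ 0 := by positivity
  have hfin := hT.finite_neighborSet hl x
  set N := hfin.toFinset with hN
  have hmem : ∀ z, z ∈ N ↔ T.Adj x z := fun z => by simp [hN]
  have hcard : N.card = l := by
    rw [← hT.2 x, Set.ncard_eq_toFinset_card _ hfin]
  have hxN : x ∉ N := by simp [hmem]
  have hsum : ∑ z ∈ insert x N, lazyKernel T l x z * f (T.dist o z)
      = f (T.dist o x) / 2 + (∑ z ∈ N, f (T.dist o z)) / (2 * l) := by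
    rw [Finset.sum_insert hxN, Finset.sum_div]
    congr 1
    · simp [lazyKernel]; ring
    · refine Finset.sum_congr rfl fun z hz => ?_
      rw [lazyKernel, if_pos ((hmem z).1 hz)]
      ring
  have hval : f (T.dist o x) / 2 + (∑ z ∈ N, f (T.dist o z)) / (2 * l)
      = μ * f (T.dist o x) := by
    rcases hk : T.dist o x with _ | k
    · have hs : ∑ z ∈ N, f (T.dist o z) = l * f 1 := by
        rw [Finset.sum_congr rfl (g := fun _ => f 1), Finset.sum_const, hcard, nsmul_eq_mul]
        intro z hz
        have := hT.1.dist_eq_dist_add_one_of_adj o ((hmem z).1 hz)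
        congr 1
        omega
      rw [hs, ← h0]
      field_simp
    · obtain ⟨y, ⟨hy, hyd⟩, huniq⟩ := existsUnique_parent hT.1 hk
      have hyN : y ∈ N := (hmem y).2 hy
      have hs : ∑ z ∈ N, f (T.dist o z) = f k + (l - 1) * f (k + 2) := by
        rw [← Finset.add_sum_erase _ _ hyN, hyd,
          Finset.sum_congr rfl (g := fun _ => f (k + 2)), Finset.sum_const,
          Finset.card_erase_of_mem hyN, hcard, nsmul_eq_mul, Nat.cast_pred hl]
        intro z hz
        obtain ⟨hzy, hzN⟩ := Finset.mem_erase.1 hz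
        have hadj := (hmem z).1 hzN
        have h := hT.1.dist_eq_dist_add_one_of_adj o hadj
        have : T.dist o z ≠ k := fun hd => hzy (huniq z ⟨hadj, hd⟩)
        congr 1
        omega
      rw [hs, ← h1]
  rw [← hval, ← hsum]
  refine hasSum_sum_of_ne_finset_zero fun z hz => ?_
  have : lazyKernel T l x z = 0 := by
    by_contra h
    rcases adj_or_eq_of_lazyKernel_ne_zero h with h | h
    · exact hz (Finset.mem_insert_of_mem ((hmem z).2 h))
    · exact hz (h ▸ Finset.mem_insert_self _ _)
  rw [this, zero_mul]

end Tree

section Kernel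

variable {V : Type*} {p : V → V → ℝ}

lemma summable_kernel_mul (hfin : ∀ x, (Function.support (p x)).Finite) (g : V → ℝ) (x : V) :
    Summable fun z => p x z * g z :=
  summable_of_hasFiniteSupport ((hfin x).subset fun _ hz => left_ne_zero_of_mul hz)

lemma kernelPow_nonneg (hp : ∀ x y, 0 ≤ p x y) (n : ℕ) (x y : V) : 0 ≤ kernelPow p n x y := by
  induction n generalizing x with
  | zero => simp only [kernelPow]; split_ifs <;> norm_num
  | succ n ih => exact tsum_nonneg fun z => mul_nonneg (hp x z) (ih z)

/-- Truncated Green function summed over the finite target set `S`. -/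
noncomputable def partialGreen (p : V → V → ℝ) (r : ℝ) (S : Finset V) (N : ℕ) (x : V) : ℝ :=
  ∑ m ∈ Finset.range N, r ^ m * ∑ y ∈ S, kernelPow p m x y

lemma partialGreen_succ (hfin : ∀ x, (Function.support (p x)).Finite) (r : ℝ) (S : Finset V)
    (N : ℕ) (x : V) :
    partialGreen p r S (N + 1) x
      = (if x ∈ S then 1 else 0) + r * ∑' z, p x z * partialGreen p r S N z := by
  have htsum : ∀ g : V → ℝ, ∑' z, p x z * g z = ∑ z ∈ (hfin x).toFinset, p x z * g z := by
    intro g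
    refine tsum_eq_sum fun z hz => ?_
    have : p x z = 0 := by simpa using hz
    rw [this, zero_mul]
  rw [partialGreen, Finset.sum_range_succ', add_comm]
  congr 1
  · simp [kernelPow]
  · simp only [kernelPow, htsum]
    simp only [partialGreen, Finset.mul_sum]
    rw [Finset.sum_comm (s := (hfin x).toFinset)]
    refine Finset.sum_congr rfl fun m _ => ?_
    rw [Finset.sum_comm]
    refine Finset.sum_congr rfl fun z _ => Finset.sum_congr rfl fun y _ => ?_
    ring

/-- Comparison principle: a nonnegative supersolution dominates the Green function. -/
lemma mul_partialGreen_le (hp : ∀ x y, 0 ≤ p x y)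
    (hfin : ∀ x, (Function.support (p x)).Finite) {r c : ℝ} (hr : 0 ≤ r) {S : Finset V}
    {φ : V → ℝ} (hφ : ∀ x, 0 ≤ φ x)
    (hsuper : ∀ x, (if x ∈ S then c else 0) + r * ∑' z, p x z * φ z ≤ φ x) (N : ℕ) (x : V) :
    c * partialGreen p r S N x ≤ φ x := by
  induction N generalizing x with
  | zero => simpa [partialGreen] using hφ x
  | succ N ih =>
    refine le_trans ?_ (hsuper x)
    rw [partialGreen_succ hfin, mul_add, mul_left_comm, ← tsum_mul_left]
    refine add_le_add (by split_ifs <;> simp) (mul_le_mul_of_nonneg_left ?_ hr)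
    have := summable_kernel_mul hfin (fun z => c * partialGreen p r S N z) x
    refine Summable.tsum_le_tsum (fun z => ?_)
      (this.congr fun z => by ring) (summable_kernel_mul hfin φ x)
    rw [mul_left_comm]
    exact mul_le_mul_of_nonneg_left (ih z) (hp x z)

/-- Comparison principle: a subsolution is dominated by the Green function, up to an error
controlled by a function which is contracted by the kernel. -/
lemma le_mul_partialGreen_add (hp : ∀ x y, 0 ≤ p x y)
    (hfin : ∀ x, (Function.support (p x)).Finite) {r C M θ : ℝ} (hr : 0 ≤ r) (hM : 0 ≤ M)
    (hθ : 0 ≤ θ) {S : Finset V} {φ g : V → ℝ}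
    (hsub : ∀ x, φ x ≤ (if x ∈ S then C else 0) + r * ∑' z, p x z * φ z)
    (hg : ∀ x, r * ∑' z, p x z * g z ≤ θ * g x) (hφg : ∀ x, φ x ≤ M * g x) (N : ℕ) (x : V) :
    φ x ≤ C * partialGreen p r S N x + M * θ ^ N * g x := by
  induction N generalizing x with
  | zero => simpa [partialGreen] using hφg x
  | succ N ih =>
    have s1 := (summable_kernel_mul hfin (partialGreen p r S N) x).mul_left C
    have s2 := (summable_kernel_mul hfin g x).mul_left (M * θ ^ N)
    have h1 : ∑' z, p x z * φ z
        ≤ C * ∑' z, p x z * partialGreen p r S N z + M * θ ^ N * ∑' z, p x z * g z := by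
      rw [← tsum_mul_left, ← tsum_mul_left, ← s1.tsum_add s2]
      refine Summable.tsum_le_tsum (fun z => ?_) (summable_kernel_mul hfin φ x) (s1.add s2)
      calc p x z * φ z ≤ p x z * (C * partialGreen p r S N z + M * θ ^ N * g z) :=
            mul_le_mul_of_nonneg_left (ih z) (hp x z)
        _ = _ := by ring
    have h2 := mul_le_mul_of_nonneg_left h1 hr
    have h3 := mul_le_mul_of_nonneg_left (hg x) (mul_nonneg hM (pow_nonneg hθ N))
    have h4 : C * (if x ∈ S then (1 : ℝ) else 0) = if x ∈ S then C else 0 := by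
      split_ifs <;> simp
    have h5 := hsub x
    rw [partialGreen_succ hfin, mul_add, h4, pow_succ]
    linarith

lemma tendsto_partialGreen (hp : ∀ x y, 0 ≤ p x y) {r B : ℝ} (hr : 0 ≤ r) {S : Finset V} {x : V}
    (hB : ∀ N, partialGreen p r S N x ≤ B) :
    Tendsto (fun N => partialGreen p r S N x) atTop (nhds (∑ y ∈ S, kernelGreen p r x y)) := by
  have hnn : ∀ m y, 0 ≤ r ^ m * kernelPow p m x y := fun m y =>
    mul_nonneg (pow_nonneg hr m) (kernelPow_nonneg hp m x y)
  have heq : ∀ N, partialGreen p r S N x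
      = ∑ y ∈ S, ∑ m ∈ Finset.range N, r ^ m * kernelPow p m x y := by
    intro N
    simp only [partialGreen, Finset.mul_sum]
    exact Finset.sum_comm
  simp only [heq] at hB ⊢
  refine tendsto_finsetSum _ fun y hy => ?_
  refine (summable_of_sum_range_le (c := B) (fun m => hnn m y) fun N => ?_).hasSum.tendsto_sum_nat
  exact (Finset.single_le_sum (f := fun y => ∑ m ∈ Finset.range N, r ^ m * kernelPow p m x y)
    (fun z _ => Finset.sum_nonneg fun m _ => hnn m z) hy).trans (hB N)

end Kernel

section Product

variable {V₁ V₂ : Type*} {p₁ : V₁ → V₁ → ℝ} {p₂ : V₂ → V₂ → ℝ} {α₁ α₂ : ℝ}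

lemma prodKernel_nonneg (h₁ : ∀ x y, 0 ≤ p₁ x y) (h₂ : ∀ x y, 0 ≤ p₂ x y) (hα₁ : 0 ≤ α₁)
    (hα₂ : 0 ≤ α₂) (x y : V₁ × V₂) : 0 ≤ prodKernel p₁ p₂ α₁ α₂ x y := by
  have := h₁ x.1 y.1
  have := h₂ x.2 y.2
  unfold prodKernel
  split_ifs <;> positivity

lemma finite_support_prodKernel (h₁ : ∀ x, (Function.support (p₁ x)).Finite)
    (h₂ : ∀ x, (Function.support (p₂ x)).Finite) (x : V₁ × V₂) :
    (Function.support (prodKernel p₁ p₂ α₁ α₂ x)).Finite := by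
  refine (((h₁ x.1).insert x.1).prod ((h₂ x.2).insert x.2)).subset fun y hy => ?_
  contrapose! hy
  simp only [Set.mem_prod, Set.mem_insert_iff, Function.mem_support, not_and_or, not_or,
    not_not] at hy
  rw [Function.mem_support, not_not, prodKernel]
  rcases hy with ⟨h, h'⟩ | ⟨h, h'⟩ <;> simp [h', Ne.symm h]

lemma hasSum_prodKernel_mul {φ₁ : V₁ → ℝ} {φ₂ : V₂ → ℝ} {s₁ s₂ : ℝ} (x : V₁ × V₂)
    (h₁ : HasSum (fun z => p₁ x.1 z * φ₁ z) s₁) (h₂ : HasSum (fun z => p₂ x.2 z * φ₂ z) s₂) :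
    HasSum (fun z => prodKernel p₁ p₂ α₁ α₂ x z * (φ₁ z.1 * φ₂ z.2))
      (α₁ * s₁ * φ₂ x.2 + α₂ * φ₁ x.1 * s₂) := by
  have hi₁ : Function.Injective fun z : V₁ => (z, x.2) := fun a b h => congrArg Prod.fst h
  have hi₂ : Function.Injective fun z : V₂ => (x.1, z) := fun a b h => congrArg Prod.snd h
  have k₁ : HasSum (fun z : V₁ × V₂ =>
      α₁ * p₁ x.1 z.1 * (if x.2 = z.2 then 1 else 0) * (φ₁ z.1 * φ₂ z.2))
      (α₁ * s₁ * φ₂ x.2) := by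
    rw [← hi₁.hasSum_iff]
    · refine HasSum.congr_fun ((h₁.mul_left α₁).mul_right (φ₂ x.2)) fun z => ?_
      simp only [Function.comp_apply, if_true]
      ring
    · rintro ⟨a, b⟩ hab
      have : x.2 ≠ b := fun h => hab ⟨a, by rw [h]⟩
      simp [this]
  have k₂ : HasSum (fun z : V₁ × V₂ =>
      α₂ * (if x.1 = z.1 then 1 else 0) * p₂ x.2 z.2 * (φ₁ z.1 * φ₂ z.2))
      (α₂ * φ₁ x.1 * s₂) := by
    rw [← hi₂.hasSum_iff]
    · refine HasSum.congr_fun (h₂.mul_left (α₂ * φ₁ x.1)) fun z => ?_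
      simp only [Function.comp_apply, if_true]
      ring
    · rintro ⟨a, b⟩ hab
      have : x.1 ≠ a := fun h => hab ⟨b, by rw [h]⟩
      simp [this]
  refine HasSum.congr_fun (k₁.add k₂) fun z => ?_
  rw [prodKernel]
  ring

end Product

section Radial

/-- The smaller root of `t² - 2 l (μ - 1/2) t + (l - 1) = 0`. -/
noncomputable def growthBase (l : ℕ) (μ : ℝ) : ℝ :=
  l * (μ - 1 / 2 - Real.sqrt ((μ - 1 / 2) ^ 2 - ((l : ℝ) - 1) / (l : ℝ) ^ 2))

/-- Above the spectral radius there is a positive radial eigenfunction, comparable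
with a power of `growthBase`. -/
lemma exists_radial {l : ℕ} (hl : 3 ≤ l) {μ : ℝ} (hμ : treeRho l < μ) :
    0 < growthBase l μ ∧ ∃ (f : ℕ → ℝ) (c C : ℝ), 0 < c ∧ 0 < C ∧
      f 0 / 2 + f 1 / 2 = μ * f 0 ∧
      (∀ k, f (k + 1) / 2 + (f k + (l - 1) * f (k + 2)) / (2 * l) = μ * f (k + 1)) ∧
      (∀ k, 0 < f k) ∧
      ∀ k, c ≤ f k * growthBase l μ ^ k ∧ f k * growthBase l μ ^ k ≤ C := by
  have hl3 : (3 : ℝ) ≤ l := by exact_mod_cast hl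
  have hl0 : (0 : ℝ) < l := by linarith
  unfold growthBase
  unfold treeRho at hμ
  obtain ⟨a, rfl⟩ : ∃ a, μ = a + 1 / 2 := ⟨μ - 1 / 2, by ring⟩
  rw [add_sub_cancel_right]
  set d := Real.sqrt ((l : ℝ) - 1) / l with hd
  have hd0 : 0 < d := div_pos (Real.sqrt_pos.2 (by linarith)) hl0
  have hd2 : d ^ 2 = ((l : ℝ) - 1) / (l : ℝ) ^ 2 := by
    rw [hd, div_pow, Real.sq_sqrt (by linarith)]
  rw [← hd2]
  have hda : d < a := by linarith
  have hdisc : 0 < a ^ 2 - d ^ 2 := by nlinarith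
  set s := Real.sqrt (a ^ 2 - d ^ 2) with hs
  have hs0 : 0 < s := Real.sqrt_pos.2 hdisc
  have hs2 : s ^ 2 = a ^ 2 - d ^ 2 := Real.sq_sqrt hdisc.le
  have hsa : s < a := by nlinarith
  have hd2' : d ^ 2 * l ^ 2 = l - 1 := by rw [hd2]; field_simp
  obtain ⟨t, ht⟩ : ∃ t, t = l * (a - s) := ⟨_, rfl⟩
  obtain ⟨t', ht'⟩ : ∃ t', t' = l * (a + s) := ⟨_, rfl⟩
  rw [← ht]
  have ht0 : 0 < t := by rw [ht]; exact mul_pos hl0 (by linarith)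
  have htt : t < t' := by rw [ht, ht']; nlinarith
  have ht0' : 0 < t' := ht0.trans htt
  have hsum : t + t' = 2 * l * a := by rw [ht, ht']; ring
  have hprod : t * t' = l - 1 := by
    rw [ht, ht']; linear_combination hd2' - (l : ℝ) ^ 2 * hs2
  clear_value s d
  have hne : t' - t ≠ 0 := by linarith
  set A := ((l - 1) * t' - t) / (l * (t' - t)) with hA
  set B := (t' - (l - 1) * t) / (l * (t' - t)) with hB
  have hA0 : 0 < A := div_pos (by nlinarith) (mul_pos hl0 (by linarith))
  have hAB : A + B = 1 := by
    rw [hA, hB]; field_simp; ring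
  have root : ∀ u, u ≠ 0 → u ^ 2 - 2 * l * a * u + (l - 1) = 0 → ∀ k : ℕ,
      (1 / u) ^ (k + 1) / 2 + ((1 / u) ^ k + (l - 1) * (1 / u) ^ (k + 2)) / (2 * l)
        = (a + 1 / 2) * (1 / u) ^ (k + 1) := by
    intro u hu h k
    have hv : ((l : ℝ) - 1) * (1 / u) ^ 2 = 2 * l * a * (1 / u) - 1 := by
      field_simp
      linarith
    have : (1 / u) ^ k + ((l : ℝ) - 1) * (1 / u) ^ (k + 2) = 2 * l * a * (1 / u) ^ (k + 1) := by
      linear_combination (1 / u) ^ k * hv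
    rw [this]
    field_simp
    ring
  have r1 := root t ht0.ne' (by rw [← hsum, ← hprod]; ring)
  have r2 := root t' ht0'.ne' (by rw [← hsum, ← hprod]; ring)
  have hf : ∀ k, (A * (1 / t) ^ k + B * (1 / t') ^ k) * t ^ k = A + B * (t / t') ^ k := by
    intro k
    simp only [div_pow, one_pow]
    field_simp
  have hq0 : ∀ k, 0 ≤ (t / t') ^ k := fun k => by positivity
  have hq1 : ∀ k, (t / t') ^ k ≤ 1 := fun k =>
    pow_le_one₀ (by positivity) ((div_le_one ht0').2 htt.le)
  have hc : ∀ k, min A 1 ≤ A + B * (t / t') ^ k := by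
    intro k
    rcases le_total 0 B with h | h
    · exact (min_le_left _ _).trans (by nlinarith [hq0 k])
    · exact (min_le_right _ _).trans (by nlinarith [hq1 k])
  have hm : 0 < min A 1 := lt_min hA0 one_pos
  refine ⟨ht0, fun k => A * (1 / t) ^ k + B * (1 / t') ^ k, min A 1, A + |B|, hm,
    by positivity, ?_, ?_, ?_, ?_⟩
  · have h1 : A / t + B / t' = 2 * a := by
      have h2 : A * t' + B * t = (l - 1) * (2 * a) := by
        rw [hA, hB]
        field_simp
        linear_combination (t' - t) * (l - 1) * hsum
      rw [div_add_div _ _ ht0.ne' ht0'.ne', hprod, div_eq_iff (by linarith)]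
      linarith
    have h3 : A * (1 / t) ^ 1 + B * (1 / t') ^ 1 = 2 * a := by rw [← h1]; ring
    have h4 : A * (1 / t) ^ 0 + B * (1 / t') ^ 0 = 1 := by simpa using hAB
    simp only [h3, h4]
    ring
  · intro k
    linear_combination A * r1 k + B * r2 k
  · intro k
    have h := hm.trans_le (hc k)
    rw [← hf k] at h
    exact pos_of_mul_pos_left h (by positivity)
  · intro k
    rw [hf k]
    refine ⟨hc k, ?_⟩
    have : B * (t / t') ^ k ≤ |B| := by
      calc B * (t / t') ^ k ≤ |B| * (t / t') ^ k :=
            mul_le_mul_of_nonneg_right (le_abs_self B) (hq0 k)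
        _ ≤ |B| * 1 := mul_le_mul_of_nonneg_left (hq1 k) (abs_nonneg B)
        _ = |B| := mul_one _
    linarith

end Radial

section Growth

variable {V₁ V₂ : Type*} {T₁ : SimpleGraph V₁} {T₂ : SimpleGraph V₂} {l : ℕ}

/-- The sphere sums of the Green function are comparable with a geometric sequence. -/
lemma exists_sphereGreenSum_bounds (hl : 3 ≤ l) (hT₁ : IsRegularTree T₁ l)
    (hT₂ : IsRegularTree T₂ l) (o₁ : V₁) (o₂ : V₂) {α₁ α₂ : ℝ} (hα₁ : 0 < α₁) (hα₂ : 0 < α₂)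
    (hα : α₁ + α₂ = 1) {r : ℝ} (hr : 0 < r) (hrR : treeRho l < r⁻¹) :
    ∃ c C : ℝ, 0 < c ∧ 0 < C ∧ ∀ n : ℕ,
      c * growthBase l r⁻¹ ^ n ≤ sphereGreenSum T₁ T₂
        (prodKernel (lazyKernel T₁ l) (lazyKernel T₂ l) α₁ α₂) (o₁, o₂) r n ∧
      sphereGreenSum T₁ T₂ (prodKernel (lazyKernel T₁ l) (lazyKernel T₂ l) α₁ α₂)
        (o₁, o₂) r n ≤ C * growthBase l r⁻¹ ^ n := by
  have hl0 : 0 < l := by omega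
  obtain ⟨μ, hμ1, hμ2⟩ := exists_between hrR
  obtain ⟨hq, f, cf, Cf, hcf, hCf, hf0, hf1, hfpos, hfb⟩ := exists_radial hl hrR
  obtain ⟨hq', g, cg, Cg, hcg, hCg, hg0, hg1, hgpos, hgb⟩ := exists_radial hl hμ1
  set q := growthBase l r⁻¹
  set q' := growthBase l μ
  have hμ0 : 0 < μ := lt_of_le_of_lt (by unfold treeRho; positivity) hμ1
  have hrμ : r * μ < 1 := by
    have := mul_lt_mul_of_pos_left hμ2 hr
    rwa [mul_inv_cancel₀ hr.ne'] at this
  set p := prodKernel (lazyKernel T₁ l) (lazyKernel T₂ l) α₁ α₂ with hpdef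
  have hp : ∀ x y, 0 ≤ p x y :=
    prodKernel_nonneg lazyKernel_nonneg lazyKernel_nonneg hα₁.le hα₂.le
  have hfin : ∀ x, (Function.support (p x)).Finite :=
    finite_support_prodKernel (hT₁.finite_support_lazyKernel hl0)
      (hT₂.finite_support_lazyKernel hl0)
  set D : V₁ × V₂ → ℕ := fun x => T₁.dist o₁ x.1 + T₂.dist o₂ x.2 with hD
  have hball : ∀ n, {x | D x ≤ n}.Finite := fun n =>
    ((hT₁.finite_ball hl0 o₁ n).prod (hT₂.finite_ball hl0 o₂ n)).subset fun x hx =>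
      ⟨(Nat.le_add_right _ _).trans hx, (Nat.le_add_left _ _).trans hx⟩
  have hDstep : ∀ x z, p x z ≠ 0 → D z ≤ D x + 1 := by
    intro x z hxz
    by_contra hlt
    have k₁ : x.2 = z.2 → lazyKernel T₁ l x.1 z.1 = 0 := fun h => by
      by_contra h'
      have := dist_le_add_one_of_lazyKernel_ne_zero hT₁.1 o₁ h'
      simp only [hD, h] at hlt
      omega
    have k₂ : x.1 = z.1 → lazyKernel T₂ l x.2 z.2 = 0 := fun h => by
      by_contra h'
      have := dist_le_add_one_of_lazyKernel_ne_zero hT₂.1 o₂ h'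
      simp only [hD, h] at hlt
      omega
    refine hxz ?_
    rw [hpdef, prodKernel]
    split_ifs with a b b <;>
      first
      | rw [k₁ a, k₂ b]; ring
      | rw [k₁ a]; ring
      | rw [k₂ b]; ring
      | ring
  set F : V₁ × V₂ → ℝ := fun x => f (T₁.dist o₁ x.1) * f (T₂.dist o₂ x.2) with hF
  set G : V₁ × V₂ → ℝ := fun x => g (T₁.dist o₁ x.1) * g (T₂.dist o₂ x.2) with hG
  have hFeig : ∀ x, r * ∑' z, p x z * F z = F x := by
    intro x
    rw [(hasSum_prodKernel_mul (α₁ := α₁) (α₂ := α₂) x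
      (hT₁.hasSum_lazyKernel_radial hl0 o₁ x.1 hf0 hf1)
      (hT₂.hasSum_lazyKernel_radial hl0 o₂ x.2 hf0 hf1)).tsum_eq]
    simp only [hF]
    field_simp
    linear_combination f (T₁.dist o₁ x.1) * f (T₂.dist o₂ x.2) * hα
  have hGeig : ∀ x, r * ∑' z, p x z * G z = r * μ * G x := by
    intro x
    rw [(hasSum_prodKernel_mul (α₁ := α₁) (α₂ := α₂) x
      (hT₁.hasSum_lazyKernel_radial hl0 o₁ x.1 hg0 hg1)
      (hT₂.hasSum_lazyKernel_radial hl0 o₂ x.2 hg0 hg1)).tsum_eq]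
    simp only [hG]
    linear_combination r * μ * g (T₁.dist o₁ x.1) * g (T₂.dist o₂ x.2) * hα
  have hFpos : ∀ x, 0 < F x := fun x => mul_pos (hfpos _) (hfpos _)
  have hGpos : ∀ x, 0 < G x := fun x => mul_pos (hgpos _) (hgpos _)
  have hbounds : ∀ {h : ℕ → ℝ} {t c C : ℝ}, 0 < c →
      (∀ k, c ≤ h k * t ^ k ∧ h k * t ^ k ≤ C) → ∀ i j : ℕ,
      c ^ 2 ≤ t ^ (i + j) * (h i * h j) ∧ t ^ (i + j) * (h i * h j) ≤ C ^ 2 := by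
    intro h t c C hc hb i j
    have e : t ^ (i + j) * (h i * h j) = (h i * t ^ i) * (h j * t ^ j) := by ring
    have pi : 0 < h i * t ^ i := hc.trans_le (hb i).1
    have pj : 0 < h j * t ^ j := hc.trans_le (hb j).1
    rw [e, sq, sq]
    exact ⟨mul_le_mul (hb i).1 (hb j).1 hc.le pi.le,
      mul_le_mul (hb i).2 (hb j).2 pj.le (pi.le.trans (hb i).2)⟩
  have hFb : ∀ x, cf ^ 2 ≤ q ^ D x * F x ∧ q ^ D x * F x ≤ Cf ^ 2 := fun x =>
    hbounds hcf hfb _ _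
  have hGb : ∀ x, cg ^ 2 ≤ q' ^ D x * G x ∧ q' ^ D x * G x ≤ Cg ^ 2 := fun x =>
    hbounds hcg hgb _ _
  have hFo : F (o₁, o₂) = f 0 ^ 2 := by simp [hF, sq]
  set K := cf ^ 2 / Cg ^ 2 with hK
  have hK0 : 0 < K := by positivity
  have hc0 : 0 < (1 - r * μ) * (K * cg ^ 2) :=
    mul_pos (by linarith) (by positivity)
  refine ⟨f 0 ^ 2 / Cf ^ 2, f 0 ^ 2 / ((1 - r * μ) * (K * cg ^ 2)),
    by have := hfpos 0; positivity, div_pos (pow_pos (hfpos 0) 2) hc0, fun n => ?_⟩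
  set S : Finset (V₁ × V₂) := (hball n).toFinset.filter fun x => D x = n with hS
  have hSmem : ∀ x, x ∈ S ↔ D x = n := by
    intro x
    simp only [hS, Finset.mem_filter, Set.Finite.mem_toFinset, Set.mem_ofPred_eq]
    omega
  have hsphere : sphereGreenSum T₁ T₂ p (o₁, o₂) r n = ∑ y ∈ S, kernelGreen p r (o₁, o₂) y := by
    rw [sphereGreenSum, tsum_eq_sum (s := S)]
    · exact Finset.sum_congr rfl fun y hy => if_pos ((hSmem y).1 hy)
    · exact fun y hy => if_neg fun h => hy ((hSmem y).2 h)
  have hupper : ∀ N, partialGreen p r S N (o₁, o₂)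
      ≤ f 0 ^ 2 / ((1 - r * μ) * (K * cg ^ 2)) * q ^ n := by
    intro N
    set φ : V₁ × V₂ → ℝ := fun x => min (q ^ n * F x) (K * q' ^ n * G x) with hφ
    have hφ0 : ∀ x, 0 ≤ φ x := fun x =>
      le_min (mul_pos (pow_pos hq n) (hFpos x)).le
        (mul_pos (mul_pos hK0 (pow_pos hq' n)) (hGpos x)).le
    have hle : ∀ x (ψ : V₁ × V₂ → ℝ), (∀ z, φ z ≤ ψ z) →
        r * ∑' z, p x z * φ z ≤ r * ∑' z, p x z * ψ z := fun x ψ h =>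
      mul_le_mul_of_nonneg_left (Summable.tsum_le_tsum
        (fun z => mul_le_mul_of_nonneg_left (h z) (hp x z))
        (summable_kernel_mul hfin φ x) (summable_kernel_mul hfin ψ x)) hr.le
    have hPF : ∀ x, r * ∑' z, p x z * φ z ≤ q ^ n * F x := by
      intro x
      refine (hle x (fun z => q ^ n * F z) fun z => min_le_left _ _).trans_eq ?_
      simp only [mul_left_comm _ (q ^ n), tsum_mul_left]
      rw [hFeig]
    have hPG : ∀ x, r * ∑' z, p x z * φ z ≤ r * μ * (K * q' ^ n * G x) := by
      intro x
      refine (hle x (fun z => K * q' ^ n * G z) fun z => min_le_right _ _).trans_eq ?_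
      simp only [mul_left_comm _ (K * q' ^ n), tsum_mul_left]
      rw [hGeig]
    have := mul_partialGreen_le hp hfin hr.le (c := (1 - r * μ) * (K * cg ^ 2)) (S := S) hφ0 ?_ N
      (o₁, o₂)
    · rw [div_mul_eq_mul_div, le_div_iff₀ hc0, mul_comm]
      refine this.trans ((min_le_left _ _).trans_eq ?_)
      rw [hFo, mul_comm]
    · intro x
      have hGx : 0 < K * q' ^ n * G x := mul_pos (mul_pos hK0 (pow_pos hq' n)) (hGpos x)
      split_ifs with hx
      · have hx' := (hSmem x).1 hx
        have hF1 := (hFb x).1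
        have hG1 := hGb x
        rw [hx'] at hF1 hG1
        have hcmp : K * q' ^ n * G x ≤ q ^ n * F x := by
          calc K * q' ^ n * G x = K * (q' ^ n * G x) := by ring
            _ ≤ K * Cg ^ 2 := mul_le_mul_of_nonneg_left hG1.2 hK0.le
            _ = cf ^ 2 := by rw [hK]; field_simp
            _ ≤ _ := hF1
        have hmin : φ x = K * q' ^ n * G x := min_eq_right hcmp
        rw [hmin]
        have h1 : (1 - r * μ) * (K * cg ^ 2) ≤ (1 - r * μ) * (K * q' ^ n * G x) := by
          rw [mul_assoc K]
          exact mul_le_mul_of_nonneg_left (mul_le_mul_of_nonneg_left hG1.1 hK0.le)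
            (by linarith)
        linarith [hPG x]
      · rw [zero_add]
        exact le_min (hPF x) ((hPG x).trans (by nlinarith))
  have hlim := tendsto_partialGreen hp hr.le hupper
  rw [hsphere]
  refine ⟨?_, le_of_tendsto' hlim hupper⟩
  set φ : V₁ × V₂ → ℝ := fun x => if D x ≤ n then q ^ n * F x else 0 with hφ
  have hφ0 : ∀ x, 0 ≤ φ x := by
    intro x
    have := hFpos x
    simp only [hφ]
    split_ifs <;> positivity
  set M := ∑ x ∈ (hball n).toFinset, q ^ n * F x / G x
  have hterm : ∀ x, 0 ≤ q ^ n * F x / G x := fun x => by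
    have := hFpos x
    have := hGpos x
    positivity
  have hM0 : 0 ≤ M := Finset.sum_nonneg fun x _ => hterm x
  have hφG : ∀ x, φ x ≤ M * G x := by
    intro x
    by_cases hx : D x ≤ n
    · rw [show φ x = q ^ n * F x from if_pos hx, ← div_le_iff₀ (hGpos x)]
      exact Finset.single_le_sum (f := fun x => q ^ n * F x / G x) (fun y _ => hterm y)
        ((Set.Finite.mem_toFinset _).2 hx)
    · rw [show φ x = 0 from if_neg hx]
      exact mul_nonneg hM0 (hGpos x).le
  have hsub : ∀ x, φ x ≤ (if x ∈ S then Cf ^ 2 else 0) + r * ∑' z, p x z * φ z := by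
    intro x
    have hP0 : 0 ≤ r * ∑' z, p x z * φ z :=
      mul_nonneg hr.le (tsum_nonneg fun z => mul_nonneg (hp x z) (hφ0 z))
    rcases lt_trichotomy (D x) n with hx | hx | hx
    · rw [if_neg (fun h => hx.ne ((hSmem x).1 h)), zero_add,
        show φ x = q ^ n * F x from if_pos hx.le]
      have : ∀ z, p x z * φ z = q ^ n * (p x z * F z) := by
        intro z
        by_cases hz : p x z = 0
        · simp [hz]
        · have := hDstep x z hz
          rw [show φ z = q ^ n * F z from if_pos (by omega)]
          ring
      rw [tsum_congr this, tsum_mul_left, mul_left_comm r, hFeig]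
    · rw [if_pos ((hSmem x).2 hx), show φ x = q ^ n * F x from if_pos hx.le]
      have := (hFb x).2
      rw [hx] at this
      linarith
    · rw [show φ x = 0 from if_neg hx.not_ge]
      split_ifs <;> positivity
  have hlow := le_mul_partialGreen_add hp hfin hr.le hM0 (mul_pos hr hμ0).le
    (fun x => by convert hsub x)
    (fun x => (hGeig x).le) hφG
  have hlim2 : Tendsto (fun N => Cf ^ 2 * partialGreen p r S N (o₁, o₂)
      + M * (r * μ) ^ N * G (o₁, o₂)) atTop
      (nhds (Cf ^ 2 * ∑ y ∈ S, kernelGreen p r (o₁, o₂) y + M * 0 * G (o₁, o₂))) :=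
    (hlim.const_mul _).add (((tendsto_pow_atTop_nhds_zero_of_lt_one (mul_pos hr hμ0).le
      hrμ).const_mul M).mul_const _)
  have hfinal := ge_of_tendsto' hlim2 fun N => hlow N (o₁, o₂)
  have hDo : D (o₁, o₂) = 0 := by simp [hD]
  rw [mul_zero, zero_mul, add_zero,
    show φ (o₁, o₂) = q ^ n * F (o₁, o₂) from if_pos (by omega), hFo] at hfinal
  rw [div_mul_eq_mul_div, div_le_iff₀ (by positivity)]
  linarith

/-- A sequence comparable with `q ^ n` has logarithmic growth rate `log q`. -/
lemma limsup_log_div_of_bounds {u : ℕ → ℝ} {c C q : ℝ} (hc : 0 < c) (hC : 0 < C) (hq : 0 < q)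
    (h : ∀ n, c * q ^ n ≤ u n ∧ u n ≤ C * q ^ n) :
    limsup (fun n : ℕ => Real.log (u n) / n) atTop = Real.log q := by
  have hlim : ∀ a : ℝ, Tendsto (fun n : ℕ => a / (n : ℝ) + Real.log q) atTop
      (nhds (Real.log q)) := fun a => by
    simpa using (tendsto_const_div_atTop_nhds_zero_nat a).add_const (Real.log q)
  have hlog : ∀ {a : ℝ} {n : ℕ}, 0 < a → 0 < n →
      Real.log (a * q ^ n) / n = Real.log a / n + Real.log q := by
    intro a n ha hn
    have : (n : ℝ) ≠ 0 := by positivity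
    rw [Real.log_mul ha.ne' (pow_pos hq n).ne', Real.log_pow]
    field_simp
  refine Tendsto.limsup_eq (tendsto_of_tendsto_of_tendsto_of_le_of_le' (hlim (Real.log c))
    (hlim (Real.log C)) ?_ ?_)
  · filter_upwards [eventually_gt_atTop 0] with n hn
    rw [← hlog hc hn]
    exact div_le_div_of_nonneg_right (Real.log_le_log (by positivity) (h n).1) n.cast_nonneg
  · filter_upwards [eventually_gt_atTop 0] with n hn
    rw [← hlog hC hn]
    have : 0 < u n := lt_of_lt_of_le (by positivity) (h n).1
    exact div_le_div_of_nonneg_right (Real.log_le_log this (h n).2) n.cast_nonneg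

end Growth

end BiTree

namespace BiTree

/-- On the product of two regular trees of equal degree `l ≥ 3`, for the
kernel `p = α₁ p₁ + α₂ p₂` and every `0 < r < R`, one has
`H_r(n) ≍ e^{n ω(r)}`, with
`ω(r) = log [ l ( r⁻¹ − 1/2 − √((r⁻¹ − 1/2)² − (l−1)/l²) ) ]`. -/
theorem bitree_equal_degree_pure_exponential {V₁ V₂ : Type*}
    (T₁ : SimpleGraph V₁) (T₂ : SimpleGraph V₂) (l : ℕ) (hl : 3 ≤ l)
    (hT₁ : IsRegularTree T₁ l) (hT₂ : IsRegularTree T₂ l) (o₁ : V₁) (o₂ : V₂)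
    (α₁ α₂ : ℝ) (hα₁ : 0 < α₁) (hα₂ : 0 < α₂) (hα : α₁ + α₂ = 1)
    (r : ℝ) (hr : 0 < r) (hrR : r < 1 / (α₁ * treeRho l + α₂ * treeRho l)) :
    (∃ C : ℝ, 1 ≤ C ∧ ∀ n : ℕ, 1 ≤ n →
      Real.exp (n * omega T₁ T₂ (prodKernel (lazyKernel T₁ l) (lazyKernel T₂ l) α₁ α₂)
          (o₁, o₂) r) / C ≤
        sphereGreenSum T₁ T₂ (prodKernel (lazyKernel T₁ l) (lazyKernel T₂ l) α₁ α₂)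
          (o₁, o₂) r n ∧
      sphereGreenSum T₁ T₂ (prodKernel (lazyKernel T₁ l) (lazyKernel T₂ l) α₁ α₂)
          (o₁, o₂) r n ≤
        C * Real.exp (n * omega T₁ T₂
          (prodKernel (lazyKernel T₁ l) (lazyKernel T₂ l) α₁ α₂) (o₁, o₂) r)) ∧
    omega T₁ T₂ (prodKernel (lazyKernel T₁ l) (lazyKernel T₂ l) α₁ α₂) (o₁, o₂) r =
      Real.log ((l : ℝ) * (r⁻¹ - 1 / 2 -
        Real.sqrt ((r⁻¹ - 1 / 2) ^ 2 - ((l : ℝ) - 1) / (l : ℝ) ^ 2))) := by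
  have hrR' : treeRho l < r⁻¹ := by
    have hρ : 0 < treeRho l := by unfold treeRho; positivity
    rw [← add_mul, hα, one_mul, lt_one_div hr hρ, one_div] at hrR
    exact hrR
  obtain ⟨c, C, hc, hC, h⟩ := exists_sphereGreenSum_bounds hl hT₁ hT₂ o₁ o₂ hα₁ hα₂ hα hr hrR'
  have hq : 0 < growthBase l r⁻¹ := (exists_radial hl hrR').1
  have hω : omega T₁ T₂ (prodKernel (lazyKernel T₁ l) (lazyKernel T₂ l) α₁ α₂) (o₁, o₂) r
      = Real.log (growthBase l r⁻¹) := limsup_log_div_of_bounds hc hC hq h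
  refine ⟨⟨max 1 (max C c⁻¹), le_max_left _ _, fun n _ => ?_⟩, hω⟩
  rw [hω, mul_comm (n : ℝ), Real.exp_mul, Real.exp_log hq, Real.rpow_natCast]
  have hqn : 0 < growthBase l r⁻¹ ^ n := pow_pos hq n
  have hmax : 0 < max 1 (max C c⁻¹) := lt_of_lt_of_le one_pos (le_max_left _ _)
  constructor
  · refine le_trans ?_ (h n).1
    have h1 : c⁻¹ ≤ max 1 (max C c⁻¹) := (le_max_right _ _).trans (le_max_right _ _)
    have h2 : 1 ≤ c * max 1 (max C c⁻¹) := by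
      calc (1 : ℝ) = c * c⁻¹ := (mul_inv_cancel₀ hc.ne').symm
        _ ≤ _ := mul_le_mul_of_nonneg_left h1 hc.le
    rw [div_le_iff₀ hmax]
    nlinarith
  · exact (h n).2.trans (mul_le_mul_of_nonneg_right
      ((le_max_left _ _).trans (le_max_right _ _)) hqn.le)

end BiTree
end
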